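/- arXiv:1402.2878 — 6 statements merged into one kernel-verified Lean document; each statement's English description precedes it below -/
import Mathlib

section
/- The number of edge-magic total labelings of the path P_3 (the path with 4 vertices and 3 edges), counted up to the reversal symmetry of the path, is 28. -/
/-- The path `P n` has vertices `0,…,n` and edges `{j,j+1}` for `0 ≤ j < n`, a total of
`2n+1` graph elements, encoded as `Fin (2n+1)` with vertex `j` at index `2j` and edge
`{j,j+1}` at index `2j+1`.  An edge-magic total labeling is a bijection from these
elements to `{1,…,2n+1}` (encoded as a permutation `σ` of `Fin (2n+1)`, the label of
element `x` being `(σ x).val + 1`) such that every edge weight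
`λ(u) + λ({u,v}) + λ(v)` equals a common constant `k`.  This counts such labelings up
to the reversal symmetry of the path, i.e. those with `λ(vertex 0) < λ(vertex n)`. -/
noncomputable def pathEMTLCountUpToRev (n : ℕ) : ℕ := by
  classical
  exact (Finset.univ.filter (fun σ : Equiv.Perm (Fin (2 * n + 1)) =>
    (∃ k : ℕ, ∀ i : Fin n,
      ((σ ⟨2 * i.1, by have := i.isLt; omega⟩).val + 1) +
      ((σ ⟨2 * i.1 + 1, by have := i.isLt; omega⟩).val + 1) +
      ((σ ⟨2 * i.1 + 2, by have := i.isLt; omega⟩).val + 1) = k) ∧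
    (σ ⟨0, by omega⟩).val < (σ ⟨2 * n, by omega⟩).val)).card

/-- The 28 labelings of `P 3` (labels shifted down by one). -/
def emtlList : List (Fin 7 → Fin 7) :=
  [![0, 4, 5, 3, 1, 2, 6], ![0, 4, 5, 3, 1, 6, 2], ![0, 4, 6, 1, 3, 2, 5],
   ![0, 4, 6, 1, 3, 5, 2], ![0, 5, 4, 3, 2, 1, 6], ![0, 5, 4, 3, 2, 6, 1],
   ![0, 6, 2, 5, 1, 3, 4], ![0, 6, 2, 5, 1, 4, 3], ![0, 6, 4, 1, 5, 2, 3],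
   ![0, 6, 4, 1, 5, 3, 2], ![1, 2, 6, 3, 0, 4, 5], ![1, 2, 6, 3, 0, 5, 4],
   ![1, 4, 3, 5, 0, 2, 6], ![1, 4, 3, 5, 0, 6, 2], ![1, 6, 2, 3, 4, 0, 5],
   ![2, 1, 6, 3, 0, 4, 5], ![2, 1, 6, 3, 0, 5, 4], ![2, 3, 5, 1, 4, 0, 6],
   ![2, 5, 3, 1, 6, 0, 4], ![2, 6, 0, 5, 3, 1, 4], ![2, 6, 1, 3, 5, 0, 4],
   ![3, 2, 5, 1, 4, 0, 6], ![3, 4, 1, 5, 2, 0, 6], ![4, 0, 5, 3, 1, 2, 6],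
   ![4, 0, 6, 1, 3, 2, 5], ![4, 1, 3, 5, 0, 2, 6], ![4, 3, 1, 5, 2, 0, 6],
   ![5, 0, 4, 3, 2, 1, 6]]

theorem emtlList_nodup : emtlList.Nodup := by decide +kernel

theorem emtlList_sound_bool : emtlList.all (fun f =>
    decide (∀ i j : Fin 7, f i = f j → i = j) &&
    (decide ((f 0).val + (f 1).val = (f 3).val + (f 4).val) &&
    (decide ((f 2).val + (f 3).val = (f 5).val + (f 6).val) &&
    decide ((f 0).val < (f 6).val)))) = true := by
  decide +kernel

theorem emtlList_sound (f : Fin 7 → Fin 7) (hf : f ∈ emtlList) : Function.Injective f ∧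
    (f 0).val + (f 1).val = (f 3).val + (f 4).val ∧
    (f 2).val + (f 3).val = (f 5).val + (f 6).val ∧ (f 0).val < (f 6).val := by
  have h := List.all_eq_true.1 emtlList_sound_bool f hf
  simp only [Bool.and_eq_true, decide_eq_true_eq] at h
  exact ⟨fun i j hij => h.1 i j hij, h.2⟩

set_option synthInstance.maxHeartbeats 400000 in
set_option synthInstance.maxSize 2000 in
theorem emtlList_complete : ∀ a g : Fin 7, a.val < g.val → ∀ b : Fin 7, b ≠ a → b ≠ g →
    ∀ d : Fin 7, d ≠ a → d ≠ b → d ≠ g →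
    ∀ e : Fin 7, a.val + b.val = d.val + e.val → e ≠ a → e ≠ b → e ≠ d → e ≠ g →
    ∀ c : Fin 7, c ≠ a → c ≠ b → c ≠ d → c ≠ e → c ≠ g →
    ∀ f : Fin 7, c.val + d.val = f.val + g.val → f ≠ a → f ≠ b → f ≠ c → f ≠ d → f ≠ e →
    f ≠ g → ![a, b, c, d, e, f, g] ∈ emtlList := by
  decide +kernel

theorem emtl_aux (σ : Equiv.Perm (Fin 7)) : (⇑σ ∈ emtlList) ↔
    (σ 0).val + (σ 1).val = (σ 3).val + (σ 4).val ∧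
    (σ 2).val + (σ 3).val = (σ 5).val + (σ 6).val ∧ (σ 0).val < (σ 6).val := by
  constructor
  · intro h
    exact (emtlList_sound _ h).2
  · rintro ⟨h1, h2, h⟩
    have ne : ∀ i j : Fin 7, i ≠ j → σ i ≠ σ j := fun i j hij e => hij (σ.injective e)
    have key := emtlList_complete (σ 0) (σ 6) h (σ 1) (ne _ _ (by decide)) (ne _ _ (by decide))
      (σ 3) (ne _ _ (by decide)) (ne _ _ (by decide)) (ne _ _ (by decide))
      (σ 4) h1 (ne _ _ (by decide)) (ne _ _ (by decide)) (ne _ _ (by decide)) (ne _ _ (by decide))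
      (σ 2) (ne _ _ (by decide)) (ne _ _ (by decide)) (ne _ _ (by decide)) (ne _ _ (by decide))
      (ne _ _ (by decide))
      (σ 5) h2 (ne _ _ (by decide)) (ne _ _ (by decide)) (ne _ _ (by decide)) (ne _ _ (by decide))
      (ne _ _ (by decide)) (ne _ _ (by decide))
    convert key using 1
    funext i
    fin_cases i <;> rfl

theorem emtl_iff (σ : Equiv.Perm (Fin (2 * 3 + 1))) :
    ((∃ k : ℕ, ∀ i : Fin 3,
      ((σ ⟨2 * i.1, by have := i.isLt; omega⟩).val + 1) +
      ((σ ⟨2 * i.1 + 1, by have := i.isLt; omega⟩).val + 1) +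
      ((σ ⟨2 * i.1 + 2, by have := i.isLt; omega⟩).val + 1) = k) ∧
    (σ ⟨0, by omega⟩).val < (σ ⟨2 * 3, by omega⟩).val) ↔ (⇑σ ∈ emtlList) := by
  rw [emtl_aux]
  constructor
  · rintro ⟨⟨k, hk⟩, h⟩
    have h0 : (σ 0).val + 1 + ((σ 1).val + 1) + ((σ 2).val + 1) = k := hk 0
    have h1 : (σ 2).val + 1 + ((σ 3).val + 1) + ((σ 4).val + 1) = k := hk 1
    have h2 : (σ 4).val + 1 + ((σ 5).val + 1) + ((σ 6).val + 1) = k := hk 2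
    exact ⟨by omega, by omega, h⟩
  · rintro ⟨h1, h2, h⟩
    have e1 : (σ 2).val + 1 + ((σ 3).val + 1) + ((σ 4).val + 1) =
      (σ 0).val + 1 + ((σ 1).val + 1) + ((σ 2).val + 1) := by omega
    have e2 : (σ 4).val + 1 + ((σ 5).val + 1) + ((σ 6).val + 1) =
      (σ 0).val + 1 + ((σ 1).val + 1) + ((σ 2).val + 1) := by omega
    refine ⟨⟨(σ 0).val + 1 + ((σ 1).val + 1) + ((σ 2).val + 1), fun i => ?_⟩, h⟩
    fin_cases i
    · rfl
    · exact e1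
    · exact e2

/-- The number of edge-magic total labelings of the path `P 3`, counted up to the
reversal symmetry of the path, is `28`. -/
theorem pathEMTLCountUpToRev_P3 : pathEMTLCountUpToRev 3 = 28 := by
  classical
  have hc : emtlList.toFinset.card = 28 := by
    rw [List.toFinset_card_of_nodup emtlList_nodup]
    rfl
  rw [← hc]
  unfold pathEMTLCountUpToRev
  refine Finset.card_bij (fun σ _ => ⇑σ) ?_ ?_ ?_
  · intro σ hσ
    exact List.mem_toFinset.2 ((emtl_iff σ).1 (Finset.mem_filter.1 hσ).2)
  · intro σ _ τ _ h
    exact DFunLike.coe_injective h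
  · intro f hf
    have hf := List.mem_toFinset.1 hf
    have hb : Function.Bijective f :=
      Finite.injective_iff_bijective.1 (emtlList_sound f hf).1
    refine ⟨Equiv.ofBijective f hb, ?_, rfl⟩
    exact Finset.mem_filter.2 ⟨Finset.mem_univ _, (emtl_iff _).2 hf⟩
end

section
/- The number of edge-magic total labelings of the path P_4 (the path with 5 vertices and 4 edges), counted up to the reversal symmetry of the path, is 48. -/
/-- Labels available. -/
def emDigits : List ℕ := [0, 1, 2, 3, 4, 5, 6, 7, 8]

/-- `x` does not occur in `l`. -/
def emFresh (x : ℕ) (l : List ℕ) : Bool :=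
  List.rec true (fun y _ r => cond (Nat.beq x y) false r) l

/-- Loop over labels not in `l` satisfying the test `p`. -/
def emLoop (l : List ℕ) (p : ℕ → Bool) (f : ℕ → List (List ℕ)) : List (List ℕ) :=
  List.rec [] (fun x _ r => cond (p x) (cond (emFresh x l) (List.append (f x) r) r) r) emDigits

/-- The label `x` with `y + x = s`, if it exists, is not in `l` and satisfies `p`. -/
def emSolve (l : List ℕ) (s y : ℕ) (p : ℕ → Bool) (f : ℕ → List (List ℕ)) : List (List ℕ) :=
  cond (Nat.ble y s) (cond (Nat.ble (Nat.sub s y) 8) (cond (p (Nat.sub s y))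
    (cond (emFresh (Nat.sub s y) l) (f (Nat.sub s y)) []) []) []) []

/-- All labelings of `P 4` (up to reversal), by pruned search. -/
def emSols : List (List ℕ) :=
  emLoop [] (fun _ => true) fun a =>
  emLoop [a] (fun _ => true) fun b =>
  emLoop [a, b] (fun _ => true) fun c =>
  emLoop [a, b, c] (fun _ => true) fun d =>
  emSolve [a, b, c, d] (a + b) d (fun _ => true) fun e =>
  emLoop [a, b, c, d, e] (fun _ => true) fun f =>
  emSolve [a, b, c, d, e, f] (c + d) f (fun _ => true) fun g =>
  emLoop [a, b, c, d, e, f, g] (fun _ => true) fun h =>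
  emSolve [a, b, c, d, e, f, g, h] (e + f) h (fun i => Nat.blt a i) fun i =>
  [[a, b, c, d, e, f, g, h, i]]

theorem emFresh_iff (x : ℕ) (l : List ℕ) : emFresh x l = true ↔ x ∉ l := by
  induction l with
  | nil => simp [emFresh]
  | cons y l ih =>
    have h : Nat.beq x y = false ↔ ¬ x = y := by
      rw [← Nat.beq_eq, Bool.not_eq_true]
    have h2 : emFresh x (y :: l) = cond (Nat.beq x y) false (emFresh x l) := rfl
    rw [h2, List.mem_cons, not_or, ← ih, ← h]
    cases Nat.beq x y <;> simp

theorem mem_emDigits (x : ℕ) : x ∈ emDigits ↔ x < 9 := by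
  simp only [emDigits, List.mem_cons, List.not_mem_nil, or_false]
  omega

theorem mem_emLoop (l : List ℕ) (p : ℕ → Bool) (f : ℕ → List (List ℕ)) (t : List ℕ) :
    t ∈ emLoop l p f ↔ ∃ x, x < 9 ∧ p x = true ∧ x ∉ l ∧ t ∈ f x := by
  have key : ∀ D : List ℕ, t ∈ (List.rec [] (fun x _ r =>
      cond (p x) (cond (emFresh x l) (List.append (f x) r) r) r) D : List (List ℕ)) ↔
      ∃ x, x ∈ D ∧ p x = true ∧ x ∉ l ∧ t ∈ f x := by
    intro D
    induction D with
    | nil => simp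
    | cons y D ih =>
      simp only [List.mem_cons, or_and_right, exists_or, exists_eq_left]
      rw [← ih, ← emFresh_iff]
      generalize (List.rec [] (fun x _ r =>
        cond (p x) (cond (emFresh x l) (List.append (f x) r) r) r) D : List (List ℕ)) = R
      cases p y <;> cases emFresh y l <;> simp
  simp only [emLoop, key, mem_emDigits]

theorem mem_emSolve (l : List ℕ) (s y : ℕ) (p : ℕ → Bool) (f : ℕ → List (List ℕ))
    (t : List ℕ) : t ∈ emSolve l s y p f ↔
      ∃ x, x < 9 ∧ (s = y + x ∧ p x = true) ∧ x ∉ l ∧ t ∈ f x := by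
  have key : t ∈ emSolve l s y p f ↔
      (y ≤ s ∧ s - y < 9 ∧ p (s - y) = true ∧ s - y ∉ l) ∧ t ∈ f (s - y) := by
    rw [← emFresh_iff, ← Nat.ble_eq, ← Nat.blt_eq, emSolve]
    change t ∈ cond (Nat.ble y s) (cond (Nat.blt (s - y) 9) (cond (p (s - y))
      (cond (emFresh (s - y) l) (f (s - y)) []) []) []) [] ↔ _
    cases Nat.ble y s <;> cases Nat.blt (s - y) 9 <;> cases p (s - y) <;>
      cases emFresh (s - y) l <;> simp
  rw [key]
  constructor
  · rintro ⟨⟨h1, h2, h3, h4⟩, h5⟩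
    exact ⟨s - y, h2, ⟨by omega, h3⟩, h4, h5⟩
  · rintro ⟨x, h2, ⟨rfl, h3⟩, h4, h5⟩
    have hx : y + x - y = x := by omega
    rw [hx]
    exact ⟨⟨by omega, h2, h3, h4⟩, h5⟩

/-- The result of the search. -/
def emList : List (List ℕ) := [
  [0, 6, 5, 4, 2, 8, 1, 3, 7], [0, 6, 5, 4, 2, 8, 1, 7, 3], [0, 6, 7, 5, 1, 4, 8, 2, 3],
  [0, 6, 7, 5, 1, 4, 8, 3, 2], [0, 6, 8, 1, 5, 2, 7, 3, 4], [0, 6, 8, 1, 5, 2, 7, 4, 3],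
  [0, 7, 6, 5, 2, 3, 8, 1, 4], [0, 7, 6, 5, 2, 3, 8, 4, 1], [0, 8, 3, 7, 1, 6, 4, 2, 5],
  [0, 8, 3, 7, 1, 6, 4, 5, 2], [0, 8, 5, 1, 7, 2, 4, 3, 6], [0, 8, 5, 1, 7, 2, 4, 6, 3],
  [1, 4, 8, 3, 2, 5, 6, 0, 7], [1, 5, 7, 0, 6, 4, 3, 2, 8], [1, 5, 7, 0, 6, 4, 3, 8, 2],
  [1, 7, 3, 8, 0, 6, 5, 2, 4], [1, 7, 3, 8, 0, 6, 5, 4, 2], [1, 7, 5, 0, 8, 2, 3, 4, 6],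
  [1, 7, 5, 0, 8, 2, 3, 6, 4], [1, 8, 2, 3, 6, 5, 0, 4, 7], [1, 8, 2, 3, 6, 5, 0, 7, 4],
  [2, 3, 8, 4, 1, 5, 7, 0, 6], [2, 4, 5, 6, 0, 8, 3, 1, 7], [2, 5, 4, 6, 1, 7, 3, 0, 8],
  [2, 8, 0, 7, 3, 6, 1, 4, 5], [2, 8, 0, 7, 3, 6, 1, 5, 4], [2, 8, 1, 3, 7, 4, 0, 5, 6],
  [2, 8, 1, 3, 7, 4, 0, 6, 5], [2, 8, 3, 4, 6, 0, 7, 1, 5], [3, 2, 8, 4, 1, 5, 7, 0, 6],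
  [3, 4, 7, 2, 5, 1, 8, 0, 6], [3, 6, 4, 2, 7, 1, 5, 0, 8], [3, 7, 1, 8, 2, 4, 5, 0, 6],
  [4, 1, 8, 3, 2, 5, 6, 0, 7], [4, 2, 5, 6, 0, 8, 3, 1, 7], [4, 3, 7, 2, 5, 1, 8, 0, 6],
  [4, 5, 1, 6, 3, 7, 0, 2, 8], [4, 6, 3, 2, 8, 0, 5, 1, 7], [4, 7, 0, 5, 6, 3, 2, 1, 8],
  [5, 1, 7, 0, 6, 4, 3, 2, 8], [5, 2, 4, 6, 1, 7, 3, 0, 8], [5, 4, 1, 6, 3, 7, 0, 2, 8],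
  [5, 6, 0, 4, 7, 3, 1, 2, 8], [6, 0, 5, 4, 2, 8, 1, 3, 7], [6, 3, 4, 2, 7, 1, 5, 0, 8],
  [6, 4, 3, 2, 8, 0, 5, 1, 7], [6, 5, 0, 4, 7, 3, 1, 2, 8], [7, 4, 0, 5, 6, 3, 2, 1, 8]]

theorem emSols_eq : emSols = emList := by
  decide +kernel

theorem emSols_nodup_length : emSols.Nodup ∧ emSols.length = 48 := by
  rw [emSols_eq]
  decide +kernel

/-- The number of edge-magic total labelings of the path `P 4`, counted up to the
reversal symmetry of the path, is `48`. -/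
theorem pathEMTLCountUpToRev_P4 : pathEMTLCountUpToRev 4 = 48 := by
  classical
  have hcard : emSols.toFinset.card = 48 := by
    rw [List.toFinset_card_of_nodup emSols_nodup_length.1, emSols_nodup_length.2]
  rw [← hcard]
  unfold pathEMTLCountUpToRev
  refine Finset.card_bij (fun σ _ => List.ofFn (fun i : Fin 9 => (σ i).val)) ?_ ?_ ?_
  · intro σ hσ
    simp only [Finset.mem_filter, Finset.mem_univ, true_and] at hσ
    obtain ⟨⟨k, hk⟩, hlt⟩ := hσ
    have h0 := hk 0
    have h1 := hk 1
    have h2 := hk 2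
    have h3 := hk 3
    have hne : ∀ i j : Fin 9, i ≠ j → (σ i).val ≠ (σ j).val := fun i j hij h =>
      hij (σ.injective (Fin.ext h))
    have hb : ∀ i : Fin 9, (σ i).val < 9 := fun i => (σ i).isLt
    change (σ 0).val + 1 + ((σ 1).val + 1) + ((σ 2).val + 1) = k at h0
    change (σ 2).val + 1 + ((σ 3).val + 1) + ((σ 4).val + 1) = k at h1
    change (σ 4).val + 1 + ((σ 5).val + 1) + ((σ 6).val + 1) = k at h2
    change (σ 6).val + 1 + ((σ 7).val + 1) + ((σ 8).val + 1) = k at h3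
    change (σ 0).val < (σ 8).val at hlt
    rw [List.mem_toFinset]
    simp only [emSols, mem_emLoop, mem_emSolve, Nat.blt_eq]
    refine ⟨(σ 0).val, hb 0, trivial, ?_, (σ 1).val, hb 1, trivial, ?_, (σ 2).val, hb 2, trivial, ?_,
      (σ 3).val, hb 3, trivial, ?_, (σ 4).val, hb 4, ⟨by omega, trivial⟩, ?_, (σ 5).val, hb 5, trivial, ?_,
      (σ 6).val, hb 6, ⟨by omega, trivial⟩, ?_, (σ 7).val, hb 7, trivial, ?_,
      (σ 8).val, hb 8, ⟨by omega, hlt⟩, ?_, ?_⟩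
    on_goal 10 => exact List.mem_singleton.2 rfl
    all_goals
      simp only [List.mem_cons, List.not_mem_nil, not_or, not_false_eq_true, or_false]
      repeat' constructor
      all_goals exact hne _ _ (by decide)
  · intro σ _ τ _ h
    have h' := List.ofFn_injective h
    ext i
    exact congrFun h' i
  · intro t ht
    rw [List.mem_toFinset] at ht
    simp only [emSols, mem_emLoop, mem_emSolve, Nat.blt_eq,
      List.mem_cons, List.not_mem_nil, or_false, not_or] at ht
    obtain ⟨a, ha, -, -, b, hb, -, hb', c, hc, -, hc', d, hd, -, hd', e, he, ⟨hE, -⟩, he',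
      f, hf, -, hf', g, hg, ⟨hG, -⟩, hg', h, hh, -, hh', i, hi, ⟨hI, hlt⟩, hi', rfl⟩ := ht
    let F : Fin 9 → Fin 9 := ![⟨a, ha⟩, ⟨b, hb⟩, ⟨c, hc⟩, ⟨d, hd⟩, ⟨e, he⟩, ⟨f, hf⟩,
      ⟨g, hg⟩, ⟨h, hh⟩, ⟨i, hi⟩]
    have hnd : [a, b, c, d, e, f, g, h, i].Nodup := by
      rw [← List.nodup_reverse]
      change [i, h, g, f, e, d, c, b, a].Nodup
      simp only [List.nodup_cons, List.mem_cons, List.not_mem_nil, or_false,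
        List.nodup_nil, not_false_eq_true, and_true, hb', hc', hd', he', hf', hg', hh', hi']
    have hof : List.ofFn (fun j : Fin 9 => (F j).val) = [a, b, c, d, e, f, g, h, i] := rfl
    have hinj : Function.Injective F := by
      rw [← hof] at hnd
      have := List.nodup_ofFn.1 hnd
      exact fun x y hxy => this (congrArg Fin.val hxy)
    refine ⟨Equiv.ofBijective F (Finite.injective_iff_bijective.1 hinj), ?_, hof⟩
    simp only [Finset.mem_filter, Finset.mem_univ, true_and, Equiv.ofBijective_apply]
    refine ⟨⟨a + 1 + (b + 1) + (c + 1), ?_⟩, hlt⟩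
    intro j
    fin_cases j
    · rfl
    · change c + 1 + (d + 1) + (e + 1) = _
      omega
    · change e + 1 + (f + 1) + (g + 1) = _
      omega
    · change g + 1 + (h + 1) + (i + 1) = _
      omega
end

section
/- The number of edge-magic total labelings of the path P_6 (the path with 7 vertices and 6 edges), counted up to the reversal symmetry of the path, is 944. -/
/-- Sum of `g v` over `v < n`, in a form that the kernel evaluates quickly. -/
def emSum (g : ℕ → ℕ) (n : ℕ) : ℕ :=
  Nat.rec (motive := fun _ => ℕ) 0 (fun v s => Nat.add (g v) s) n

/-- Kernel-friendly `if b then x else 0`. -/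
def emIf (b : Bool) (x : ℕ) : ℕ := Bool.rec (motive := fun _ => ℕ) 0 x b

/-- Evaluate `x` before passing it on. -/
def emForce (h : ℕ → ℕ) (x : ℕ) : ℕ :=
  Nat.rec (motive := fun _ => ℕ) (h 0) (fun n _ => h (Nat.succ n)) x

/-- Bit test. -/
def emBit (f v : ℕ) : Bool := Nat.beq (Nat.land 1 (Nat.shiftRight f v)) 1

/-- Number of ways to prolong a partial labeling by `n` more edges; `u0` is the first label,
`u` the last vertex label, `f` the bit mask of the unused labels. -/
def emCnt (K u0 n : ℕ) : ℕ → ℕ → ℕ :=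
  Nat.rec (motive := fun _ => ℕ → ℕ → ℕ)
    (fun u _ => emIf (Nat.ble (Nat.succ u0) u) 1)
    (fun _ ih u f => emSum (fun v => emIf (emBit f v)
      (emForce (fun e => emIf (emBit f e)
        (Bool.rec (motive := fun _ => ℕ)
          (emForce (ih v) (Nat.xor (Nat.xor f (Nat.pow 2 v)) (Nat.pow 2 e))) 0 (Nat.beq e v)))
        (Nat.sub K (Nat.add u v)))) 14) n

/-- Count for the magic constant `K`. -/
def emRow (K : ℕ) : ℕ :=
  emSum (fun u => emIf (emBit 16382 u)
    (emForce (emCnt K u 6 u) (Nat.xor 16382 (Nat.pow 2 u)))) 14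

/-- Total count. -/
def emTotal : ℕ := emSum emRow 40

/-- Count for the magic constants `K` with `a ≤ K < a + n`. -/
def emRows (a n : ℕ) : ℕ := emSum (fun i => emRow (Nat.add a i)) n

theorem emRows_0 : emRows 0 11 = 0 := by decide +kernel

theorem emRows_11 : emRows 11 3 = 0 := by decide +kernel

theorem emRows_14 : emRows 14 2 = 0 := by decide +kernel

theorem emRows_16 : emRows 16 1 = 0 := by decide +kernel

theorem emRows_17 : emRows 17 1 = 0 := by decide +kernel

theorem emRows_18 : emRows 18 1 = 44 := by decide +kernel

theorem emRows_19 : emRows 19 1 = 116 := by decide +kernel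

theorem emRows_20 : emRows 20 1 = 184 := by decide +kernel

theorem emRows_21 : emRows 21 1 = 256 := by decide +kernel

theorem emRows_22 : emRows 22 1 = 184 := by decide +kernel

theorem emRows_23 : emRows 23 1 = 116 := by decide +kernel

theorem emRows_24 : emRows 24 1 = 44 := by decide +kernel

theorem emRows_25 : emRows 25 1 = 0 := by decide +kernel

theorem emRows_26 : emRows 26 1 = 0 := by decide +kernel

theorem emRows_27 : emRows 27 2 = 0 := by decide +kernel

theorem emRows_29 : emRows 29 3 = 0 := by decide +kernel

theorem emRows_32 : emRows 32 8 = 0 := by decide +kernel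

theorem emRows_add (a n m : ℕ) : emRows a (n + m) = emRows a n + emRows (a + n) m := by
  induction m with
  | zero => rfl
  | succ m ih =>
    have h1 : emRows a (n + (m + 1)) = emRow (a + (n + m)) + emRows a (n + m) := rfl
    have h2 : emRows (a + n) (m + 1) = emRow (a + n + m) + emRows (a + n) m := rfl
    rw [h1, h2, ih, add_assoc a n m]
    omega

theorem emRows_zero (n : ℕ) : emRows 0 n = emSum emRow n := by
  have h : (fun i => emRow (Nat.add 0 i)) = emRow := by
    funext i
    exact congrArg emRow (Nat.zero_add i)
  rw [emRows, h]

theorem emTotal_eq : emTotal = 944 := by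
  rw [emTotal, ← emRows_zero]
  have s11 := emRows_add 0 11 3
  have s14 := emRows_add 0 14 2
  have s16 := emRows_add 0 16 1
  have s17 := emRows_add 0 17 1
  have s18 := emRows_add 0 18 1
  have s19 := emRows_add 0 19 1
  have s20 := emRows_add 0 20 1
  have s21 := emRows_add 0 21 1
  have s22 := emRows_add 0 22 1
  have s23 := emRows_add 0 23 1
  have s24 := emRows_add 0 24 1
  have s25 := emRows_add 0 25 1
  have s26 := emRows_add 0 26 1
  have s27 := emRows_add 0 27 2
  have s29 := emRows_add 0 29 3
  have s32 := emRows_add 0 32 8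
  simp only [Nat.zero_add, Nat.reduceAdd] at s11 s14 s16 s17 s18 s19 s20 s21 s22 s23 s24 s25 s26 s27 s29 s32
  rw [s32, s29, s27, s26, s25, s24, s23, s22, s21, s20, s19, s18, s17, s16, s14, s11,
    emRows_0, emRows_11, emRows_14, emRows_16, emRows_17, emRows_18, emRows_19, emRows_20, emRows_21, emRows_22, emRows_23, emRows_24, emRows_25, emRows_26, emRows_27, emRows_29, emRows_32]

theorem emSum_eq (g : ℕ → ℕ) (n : ℕ) : emSum g n = ((List.range n).map g).sum := by
  induction n with
  | zero => rfl
  | succ n ih =>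
    have : emSum g (n+1) = g n + emSum g n := rfl
    rw [this, ih, List.range_succ]
    simp [add_comm]

theorem emIf_eq (b : Bool) (x : ℕ) : emIf b x = if b = true then x else 0 := by
  cases b <;> rfl

theorem emForce_eq (h : ℕ → ℕ) (x : ℕ) : emForce h x = h x := by
  cases x <;> rfl

theorem emBeq (a b : ℕ) : Nat.beq a b = true ↔ a = b :=
  ⟨Nat.eq_of_beq_eq_true, fun h => by rw [h]; exact Nat.beq_refl b⟩

theorem emBit_eq (f v : ℕ) : emBit f v = f.testBit v := by
  have h : emBit f v = Nat.beq (1 &&& (f >>> v)) 1 := rfl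
  rw [h, Nat.testBit, Bool.eq_iff_iff, emBeq, Nat.one_and_eq_mod_two]
  simp only [bne_iff_ne]
  omega

/-- The extensions counted by `emCnt`, as lists of alternating edge and vertex labels. -/
def emExt (K u0 : ℕ) : ℕ → ℕ → ℕ → List (List ℕ)
  | 0, u, _ => if u0 < u then [[]] else []
  | n + 1, u, f => (List.range 14).flatMap fun v =>
      if f.testBit v = true ∧ f.testBit (K - (u + v)) = true ∧ K - (u + v) ≠ v then
        (emExt K u0 n v ((f ^^^ 2 ^ v) ^^^ 2 ^ (K - (u + v)))).map
          (fun t => (K - (u + v)) :: v :: t)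
      else []

theorem emCnt_zero (K u0 u f : ℕ) : emCnt K u0 0 u f = if u0 < u then 1 else 0 := by
  have h : emCnt K u0 0 u f = emIf (Nat.ble (Nat.succ u0) u) 1 := rfl
  rw [h, emIf_eq]
  simp only [Nat.ble_eq, Nat.succ_le_iff]

theorem emCnt_succ (K u0 n u f : ℕ) : emCnt K u0 (n+1) u f =
    emSum (fun v => emIf (emBit f v)
      (emForce (fun e => emIf (emBit f e)
        (Bool.rec (motive := fun _ => ℕ)
          (emForce (emCnt K u0 n v) ((f ^^^ 2 ^ v) ^^^ 2 ^ e)) 0 (Nat.beq e v)))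
        (K - (u + v)))) 14 := rfl

theorem emExt_length (K u0 n u f : ℕ) : (emExt K u0 n u f).length = emCnt K u0 n u f := by
  induction n generalizing u f with
  | zero =>
    rw [emCnt_zero, emExt]
    split_ifs <;> rfl
  | succ n ih =>
    rw [emCnt_succ, emExt, emSum_eq, List.length_flatMap]
    congr 1
    apply List.map_congr_left
    intro v _
    rw [emIf_eq, emForce_eq, emIf_eq, emBit_eq, emBit_eq, emForce_eq, ← ih]
    by_cases h3 : K - (u + v) = v
    · have : Nat.beq (K - (u + v)) v = true := by rw [emBeq]; exact h3
      rw [this]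
      simp [h3]
    · have : Nat.beq (K - (u + v)) v = false := by
        rw [← Bool.not_eq_true, emBeq]; exact h3
      rw [this]
      by_cases h1 : f.testBit v = true <;> by_cases h2 : f.testBit (K - (u + v)) = true <;>
        simp [h1, h2, h3]

/-- The list `t` prolongs a path ending in `u` with constant edge weight `K`,
and its last vertex label exceeds `u0`. -/
def emGood (K u0 : ℕ) : ℕ → List ℕ → Prop
  | u, [] => u0 < u
  | _, [_] => False
  | u, e :: v :: t => u + e + v = K ∧ emGood K u0 v t

theorem emMask (f v e x : ℕ) (h : e ≠ v) (hv : f.testBit v = true) (he : f.testBit e = true) :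
    ((f ^^^ 2 ^ v) ^^^ 2 ^ e).testBit x = true ↔ f.testBit x = true ∧ x ≠ v ∧ x ≠ e := by
  rw [Nat.testBit_xor, Nat.testBit_xor, Nat.testBit_two_pow, Nat.testBit_two_pow]
  by_cases h1 : v = x
  · subst h1; simp [h, hv]
  · by_cases h2 : e = x
    · subst h2; simp [he, h1]
    · simp [h1, h2, Ne.symm h1, Ne.symm h2]

theorem mem_emExt (K u0 n u f : ℕ) (hf : ∀ x, f.testBit x = true → 1 ≤ x ∧ x < 14) (t : List ℕ) :
    t ∈ emExt K u0 n u f ↔ t.length = 2 * n ∧ t.Nodup ∧ (∀ x ∈ t, f.testBit x = true) ∧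
      emGood K u0 u t := by
  induction n generalizing u f t with
  | zero =>
    rw [emExt]
    cases t with
    | nil => split_ifs with h <;> simp [emGood, h]
    | cons a t => split_ifs with h <;> simp
  | succ n ih =>
    rw [emExt]
    simp only [List.mem_flatMap, List.mem_range]
    constructor
    · rintro ⟨v, hv, ht⟩
      split_ifs at ht with h
      · obtain ⟨h1, h2, h3⟩ := h
        rw [List.mem_map] at ht
        obtain ⟨s, hs, rfl⟩ := ht
        rw [ih] at hs
        · obtain ⟨a1, a2, a3, a4⟩ := hs
          simp only [emMask f v _ _ h3 h1 h2] at a3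
          have := hf _ h2
          refine ⟨by simp [a1]; omega, ?_, ?_, by omega, a4⟩
          · simp only [List.nodup_cons, List.mem_cons, not_or]
            exact ⟨⟨h3, fun h => (a3 _ h).2.2 rfl⟩, fun h => (a3 _ h).2.1 rfl, a2⟩
          · intro x hx
            simp only [List.mem_cons] at hx
            rcases hx with rfl | rfl | hx
            · exact h2
            · exact h1
            · exact (a3 _ hx).1
        · intro x hx
          rw [emMask f v _ _ h3 h1 h2] at hx
          exact hf x hx.1
      · simp at ht
    · rintro ⟨a1, a2, a3, a4⟩
      match t, a1, a2, a3, a4 with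
      | [], a1, _, _, _ => simp at a1
      | [_], _, _, _, a4 => exact a4.elim
      | e :: v :: s, a1, a2, a3, a4 =>
        obtain ⟨b1, b2⟩ := a4
        have he : f.testBit e = true := a3 e (by simp)
        have hv : f.testBit v = true := a3 v (by simp)
        simp only [List.nodup_cons, List.mem_cons, not_or] at a2
        obtain ⟨⟨c1, c2⟩, c3, c4⟩ := a2
        have hK : K - (u + v) = e := by omega
        refine ⟨v, (hf v hv).2, ?_⟩
        rw [hK, if_pos ⟨hv, he, c1⟩, List.mem_map]
        refine ⟨s, ?_, rfl⟩
        rw [ih]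
        · refine ⟨by simp at a1; omega, c4, ?_, b2⟩
          intro x hx
          rw [emMask f v e x c1 hv he]
          exact ⟨a3 x (by simp [hx]), fun h => c3 (h ▸ hx), fun h => c2 (h ▸ hx)⟩
        · intro x hx
          rw [emMask f v e x c1 hv he] at hx
          exact hf x hx.1

theorem emExt_nodup (K u0 n u f : ℕ) : (emExt K u0 n u f).Nodup := by
  induction n generalizing u f with
  | zero => rw [emExt]; split_ifs <;> simp
  | succ n ih =>
    rw [emExt, List.nodup_flatMap]
    constructor
    · intro v _
      split_ifs
      · refine (ih _ _).map ?_
        intro a b h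
        simpa using h
      · simp
    · refine List.Pairwise.imp ?_ (List.nodup_range (n := 14))
      intro v w hvw x hx hy
      beta_reduce at hx hy
      split_ifs at hx hy
      · simp only [List.mem_map] at hx hy
        obtain ⟨s, _, rfl⟩ := hx
        obtain ⟨s', _, h⟩ := hy
        simp only [List.cons.injEq] at h
        exact hvw h.2.1.symm
      all_goals simp at hx hy

/-- All labelings, as lists of labels. -/
def emAll : List (List ℕ) :=
  (List.range 40).flatMap fun K => (List.range 14).flatMap fun u =>
    if Nat.testBit 16382 u = true then (emExt K u 6 u (16382 ^^^ 2 ^ u)).map (fun t => u :: t)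
    else []

theorem emAll_length : emAll.length = 944 := by
  rw [← emTotal_eq, emTotal, emAll, List.length_flatMap, emSum_eq]
  refine congrArg List.sum (List.map_congr_left ?_)
  intro K _
  rw [List.length_flatMap, emRow, emSum_eq]
  refine congrArg List.sum (List.map_congr_left ?_)
  intro u _
  rw [emIf_eq, emForce_eq, emBit_eq]
  split_ifs
  · rw [List.length_map, emExt_length]; rfl
  · rfl

theorem emFull (x : ℕ) : Nat.testBit 16382 x = true ↔ 1 ≤ x ∧ x < 14 := by
  constructor
  · intro h
    have h2 : x < 14 := by
      by_contra hc
      have : Nat.testBit 16382 x = false := Nat.testBit_lt_two_pow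
        (lt_of_lt_of_le (by norm_num : 16382 < 2 ^ 14)
          (Nat.pow_le_pow_right (by norm_num) (by omega)))
      simp [this] at h
    refine ⟨?_, h2⟩
    by_contra hc
    have : x = 0 := by omega
    subst this
    revert h
    decide
  · rintro ⟨h1, h2⟩
    interval_cases x <;> decide

theorem emFull_xor (u x : ℕ) (hu : Nat.testBit 16382 u = true) :
    Nat.testBit (16382 ^^^ 2 ^ u) x = true ↔ (1 ≤ x ∧ x < 14) ∧ x ≠ u := by
  rw [← emFull, Nat.testBit_xor, Nat.testBit_two_pow]
  by_cases h : u = x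
  · subst h; simp [hu]
  · simp [h, Ne.symm h]

theorem mem_emAll (m : List ℕ) : m ∈ emAll ↔ ∃ K < 40, ∃ u t, m = u :: t ∧ t.length = 12 ∧
    m.Nodup ∧ (∀ x ∈ m, 1 ≤ x ∧ x < 14) ∧ emGood K u u t := by
  simp only [emAll, List.mem_flatMap, List.mem_range]
  constructor
  · rintro ⟨K, hK, u, hu, h⟩
    split_ifs at h with hb
    · rw [List.mem_map] at h
      obtain ⟨t, ht, rfl⟩ := h
      rw [mem_emExt] at ht
      · obtain ⟨a1, a2, a3, a4⟩ := ht
        simp only [emFull_xor u _ hb] at a3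
        refine ⟨K, hK, u, t, rfl, a1, List.nodup_cons.2 ⟨fun h => (a3 u h).2 rfl, a2⟩, ?_, a4⟩
        intro x hx
        rcases List.mem_cons.1 hx with rfl | hx
        · exact (emFull _).1 hb
        · exact (a3 x hx).1
      · intro x hx
        exact ((emFull_xor u x hb).1 hx).1
    · simp at h
  · rintro ⟨K, hK, u, t, rfl, a1, a2, a3, a4⟩
    have hu := a3 u (by simp)
    have hb := (emFull u).2 hu
    refine ⟨K, hK, u, hu.2, ?_⟩
    rw [if_pos hb, List.mem_map]
    refine ⟨t, ?_, rfl⟩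
    rw [mem_emExt]
    · refine ⟨a1, (List.nodup_cons.1 a2).2, ?_, a4⟩
      intro x hx
      rw [emFull_xor u x hb]
      exact ⟨a3 x (by simp [hx]), fun h => (List.nodup_cons.1 a2).1 (h ▸ hx)⟩
    · intro x hx
      exact ((emFull_xor u x hb).1 hx).1

theorem emAll_nodup : emAll.Nodup := by
  rw [emAll, List.nodup_flatMap]
  constructor
  · intro K _
    rw [List.nodup_flatMap]
    constructor
    · intro u _
      split_ifs
      · refine (emExt_nodup _ _ _ _ _).map ?_
        intro a b h
        simpa using h
      · simp
    · refine List.Pairwise.imp ?_ (List.nodup_range (n := 14))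
      intro v w hvw x hx hy
      beta_reduce at hx hy
      split_ifs at hx hy
      · simp only [List.mem_map] at hx hy
        obtain ⟨s, _, rfl⟩ := hx
        obtain ⟨s', _, h⟩ := hy
        simp only [List.cons.injEq] at h
        exact hvw h.1.symm
      all_goals simp at hx hy
  · refine List.Pairwise.imp ?_ (List.nodup_range (n := 40))
    intro K L hKL x hx hy
    simp only [List.mem_flatMap] at hx hy
    obtain ⟨u, _, hx⟩ := hx
    obtain ⟨w, _, hy⟩ := hy
    split_ifs at hx hy with h1 h2
    · simp only [List.mem_map] at hx hy
      obtain ⟨s, hs, rfl⟩ := hx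
      obtain ⟨s', hs', h⟩ := hy
      simp only [List.cons.injEq] at h
      obtain ⟨rfl, rfl⟩ := h
      rw [mem_emExt _ _ _ _ _ (fun x hx => ((emFull_xor w x h1).1 hx).1)] at hs hs'
      obtain ⟨a1, _, _, a4⟩ := hs
      obtain ⟨_, _, _, b4⟩ := hs'
      match s', a1, a4, b4 with
      | [], a1, _, _ => simp at a1
      | [_], _, a4, _ => exact a4
      | e :: v :: t, _, a4, b4 => exact hKL (a4.1.symm.trans b4.1)
    all_goals simp at hx hy

theorem emMain_iff (σ : Equiv.Perm (Fin 13)) :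
    ((∃ k : ℕ, ∀ i : Fin 6,
      ((σ ⟨2 * i.1, by have := i.isLt; omega⟩).val + 1) +
      ((σ ⟨2 * i.1 + 1, by have := i.isLt; omega⟩).val + 1) +
      ((σ ⟨2 * i.1 + 2, by have := i.isLt; omega⟩).val + 1) = k) ∧
    (σ 0).val < (σ 12).val) ↔ List.ofFn (fun i => (σ i).val + 1) ∈ emAll := by
  have hnd : (List.ofFn (fun i => (σ i).val + 1)).Nodup := by
    rw [List.nodup_ofFn]
    intro a b h
    simp only [Nat.add_right_cancel_iff] at h
    exact σ.injective (Fin.ext h)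
  have hall : ∀ x ∈ List.ofFn (fun i => (σ i).val + 1), 1 ≤ x ∧ x < 14 := by
    intro x hx
    rw [List.mem_ofFn] at hx
    obtain ⟨i, rfl⟩ := hx
    have := (σ i).isLt
    omega
  rw [mem_emAll]
  have h0 := (σ 0).isLt
  have h1 := (σ 1).isLt
  have h2 := (σ 2).isLt
  constructor
  · rintro ⟨⟨k, hk⟩, hlt⟩
    have k0 := hk 0
    have k1 := hk 1
    have k2 := hk 2
    have k3 := hk 3
    have k4 := hk 4
    have k5 := hk 5
    refine ⟨k, ?_, (σ 0).val + 1, List.ofFn (fun i : Fin 12 => (σ i.succ).val + 1),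
      ?_, by simp, hnd, hall, ?_⟩
    · have : (σ 0).val + 1 + ((σ 1).val + 1) + ((σ 2).val + 1) = k := k0
      omega
    · rw [List.ofFn_succ]
    · exact ⟨k0, k1, k2, k3, k4, k5, Nat.succ_lt_succ hlt⟩
  · rintro ⟨K, hK, u, t, hm, ht, -, -, hg⟩
    rw [List.ofFn_succ, List.cons.injEq] at hm
    obtain ⟨rfl, rfl⟩ := hm
    obtain ⟨k0, k1, k2, k3, k4, k5, hlt⟩ := hg
    refine ⟨⟨K, ?_⟩, Nat.lt_of_succ_lt_succ hlt⟩
    intro i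
    fin_cases i
    · exact k0
    · exact k1
    · exact k2
    · exact k3
    · exact k4
    · exact k5

theorem emSurj (m : List ℕ) (hm : m ∈ emAll) :
    ∃ σ : Equiv.Perm (Fin 13), List.ofFn (fun i => (σ i).val + 1) = m := by
  rw [mem_emAll] at hm
  obtain ⟨K, _, u, t, h, hl, hn, ha, _⟩ := hm
  have hlen : m.length = 13 := by rw [h]; simp [hl]
  have hb : ∀ i : Fin 13, 1 ≤ m[i.val]'(by omega) ∧ m[i.val]'(by omega) < 14 :=
    fun i => ha _ (List.getElem_mem _)
  let g : Fin 13 → Fin 13 := fun i => ⟨m[i.val]'(by omega) - 1, by have := hb i; omega⟩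
  have hg : Function.Injective g := by
    intro i j hij
    have h1 := hb i
    have h2 := hb j
    have h3 : m[i.val]'(by omega) - 1 = m[j.val]'(by omega) - 1 := congrArg Fin.val hij
    have h4 : m[i.val]'(by omega) = m[j.val]'(by omega) := by omega
    exact Fin.ext ((hn.getElem_inj_iff).1 h4)
  refine ⟨Equiv.ofBijective g (Finite.injective_iff_bijective.1 hg), ?_⟩
  apply List.ext_getElem
  · simp [hlen]
  · intro i h1 h2
    rw [List.getElem_ofFn]
    have := hb ⟨i, by omega⟩
    simp only [Equiv.ofBijective_apply, g]
    simp only at this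
    omega

/-- The number of edge-magic total labelings of the path `P 6`, counted up to the
reversal symmetry of the path, is `944`. -/
theorem pathEMTLCountUpToRev_P6 : pathEMTLCountUpToRev 6 = 944 := by
  classical
  rw [← emAll_length, ← List.toFinset_card_of_nodup emAll_nodup]
  unfold pathEMTLCountUpToRev
  refine Finset.card_bij
    (fun (σ : Equiv.Perm (Fin 13)) _ => List.ofFn (fun i => (σ i).val + 1)) ?_ ?_ ?_
  · intro σ hσ
    rw [List.mem_toFinset]
    exact (emMain_iff σ).1 (Finset.mem_filter.1 hσ).2
  · intro σ _ τ _ h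
    have h := List.ofFn_injective h
    apply Equiv.ext
    intro i
    have := congrFun h i
    exact Fin.ext (Nat.succ_injective this)
  · intro m hm
    rw [List.mem_toFinset] at hm
    obtain ⟨σ, rfl⟩ := emSurj m hm
    exact ⟨σ, Finset.mem_filter.2 ⟨Finset.mem_univ _, (emMain_iff σ).2 hm⟩, rfl⟩
end

section
/- The number of edge-magic total labelings of the path P_7 (the path with 8 vertices and 7 edges), counted up to the reversal symmetry of the path, is 5344. -/
namespace EMTL

/-- One search step: choose the next vertex label `v`, with edge label `k - (last + v)`.
`f` is the mask of free labels, `g` the reversed mask, `R` the sum of the inner vertex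
labels still to be chosen. -/
noncomputable def step (k last f g R : ℕ) (ih : ℕ → ℕ → ℕ → ℕ → ℕ) (v : ℕ) : ℕ :=
  ih v (Nat.xor (Nat.xor f (Nat.pow (nat_lit 2) v)) (Nat.pow (nat_lit 2) (Nat.sub k (Nat.add last v))))
    (Nat.xor (Nat.xor g (Nat.pow (nat_lit 2) (Nat.sub (nat_lit 30) v))) (Nat.pow (nat_lit 2) (Nat.sub (nat_lit 30) (Nat.sub k (Nat.add last v)))))
    (Nat.sub R v)

/-- Sum of `F v` over the bits `v < 15` of the mask `M`, unrolled for fast reduction. -/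
noncomputable def loop (F : ℕ → ℕ) (M : ℕ) : ℕ :=
  Nat.add (Nat.rec (motive := fun _ => ℕ) 0 (fun _ _ => F (nat_lit 0)) (Nat.land M (nat_lit 1)))
  (Nat.add (Nat.rec (motive := fun _ => ℕ) 0 (fun _ _ => F (nat_lit 1)) (Nat.land M (nat_lit 2)))
  (Nat.add (Nat.rec (motive := fun _ => ℕ) 0 (fun _ _ => F (nat_lit 2)) (Nat.land M (nat_lit 4)))
  (Nat.add (Nat.rec (motive := fun _ => ℕ) 0 (fun _ _ => F (nat_lit 3)) (Nat.land M (nat_lit 8)))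
  (Nat.add (Nat.rec (motive := fun _ => ℕ) 0 (fun _ _ => F (nat_lit 4)) (Nat.land M (nat_lit 16)))
  (Nat.add (Nat.rec (motive := fun _ => ℕ) 0 (fun _ _ => F (nat_lit 5)) (Nat.land M (nat_lit 32)))
  (Nat.add (Nat.rec (motive := fun _ => ℕ) 0 (fun _ _ => F (nat_lit 6)) (Nat.land M (nat_lit 64)))
  (Nat.add (Nat.rec (motive := fun _ => ℕ) 0 (fun _ _ => F (nat_lit 7)) (Nat.land M (nat_lit 128)))
  (Nat.add (Nat.rec (motive := fun _ => ℕ) 0 (fun _ _ => F (nat_lit 8)) (Nat.land M (nat_lit 256)))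
  (Nat.add (Nat.rec (motive := fun _ => ℕ) 0 (fun _ _ => F (nat_lit 9)) (Nat.land M (nat_lit 512)))
  (Nat.add (Nat.rec (motive := fun _ => ℕ) 0 (fun _ _ => F (nat_lit 10)) (Nat.land M (nat_lit 1024)))
  (Nat.add (Nat.rec (motive := fun _ => ℕ) 0 (fun _ _ => F (nat_lit 11)) (Nat.land M (nat_lit 2048)))
  (Nat.add (Nat.rec (motive := fun _ => ℕ) 0 (fun _ _ => F (nat_lit 12)) (Nat.land M (nat_lit 4096)))
  (Nat.add (Nat.rec (motive := fun _ => ℕ) 0 (fun _ _ => F (nat_lit 13)) (Nat.land M (nat_lit 8192)))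
  (Nat.rec (motive := fun _ => ℕ) 0 (fun _ _ => F (nat_lit 14)) (Nat.land M (nat_lit 16384))))))))))))))))

/-- Mask of the candidates for the next vertex label. -/
noncomputable def msk (k last f g : ℕ) : ℕ :=
   Nat.land f (Nat.shiftRight g (Nat.sub (nat_lit 30) (Nat.sub k last)))

/-- `step`, skipping the case where the vertex and the edge label coincide. -/
noncomputable def stepc (k last f g R : ℕ) (ih : ℕ → ℕ → ℕ → ℕ → ℕ) (v : ℕ) : ℕ :=
  Bool.rec (motive := fun _ => ℕ) (step k last f g R ih v) 0 (Nat.beq (Nat.add v (Nat.add v last)) k)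

/-- The number of completions with `d` edges left. -/
noncomputable def cnt (k v0 : ℕ) (d : ℕ) : ℕ → ℕ → ℕ → ℕ → ℕ :=
  Nat.rec (motive := fun _ => ℕ → ℕ → ℕ → ℕ → ℕ) (fun last _ _ _ => Nat.rec (motive := fun _ => ℕ) 0 (fun _ _ => 1) (Nat.sub last v0))
    (fun d ih last f g R =>
        Bool.rec (motive := fun _ => ℕ) (Bool.rec (motive := fun _ => ℕ) (loop (stepc k last f g R ih) (msk k last f g))
           (Nat.rec (motive := fun _ => ℕ) 0 (fun _ _ => loop (stepc k last f g R ih) (msk k last f g)) (Nat.land (nat_lit 1) (Nat.shiftRight f (Nat.sub k R)))) (Nat.beq d 2))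
           (Nat.rec (motive := fun _ => ℕ) 0 (fun _ _ => stepc k last f g R ih R) (Nat.land (msk k last f g) (Nat.pow (nat_lit 2) R))) (Nat.beq d 1)) d

/-- The number of labelings with (0-based) magic constant `k`. -/
noncomputable def cntK (k : ℕ) : ℕ :=
  loop (fun v =>
    (cnt k v 7 v (Nat.xor 32767 (Nat.pow 2 v)) (Nat.xor 2147418112 (Nat.pow 2 (Nat.sub 30 v))) (Nat.sub (Nat.mul 7 k) 105))) 32767

/-- The solutions found by the search, as lists. -/
def gen (k v0 : ℕ) : ℕ → ℕ → ℕ → ℕ → List (List ℕ)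
  | 0, last, _, _ => if v0 < last then [[]] else []
  | d + 1, last, f, R => (List.range 15).flatMap fun v =>
      if (f.testBit v = true ∧ last + v ≤ k ∧ f.testBit (k - (last + v)) = true) ∧
          v + (v + last) ≠ k ∧ (d = 1 → v = R) ∧ (d = 2 → f.testBit (k - R) = true) then
        (gen k v0 d v ((f ^^^ 2 ^ v) ^^^ 2 ^ (k - (last + v))) (R - v)).map
          (fun t => (k - (last + v)) :: v :: t)
      else []

theorem rec_eq (n x : ℕ) :
    (Nat.rec (motive := fun _ => ℕ) 0 (fun _ _ => x) n : ℕ) = if n = 0 then 0 else x := by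
  cases n <;> simp

theorem brec_eq (b : Bool) (x y : ℕ) :
    (Bool.rec (motive := fun _ => ℕ) x y b : ℕ) = if b = true then y else x := by
  cases b <;> simp

theorem nbeq (a b : ℕ) : Nat.beq a b = true ↔ a = b :=
  ⟨Nat.eq_of_beq_eq_true, fun h => h ▸ Nat.beq_refl a⟩

theorem and_pow_eq (M v : ℕ) : Nat.land M (2 ^ v) = 0 ↔ M.testBit v = false := by
  have h := Nat.and_two_pow M v
  change M &&& 2 ^ v = 0 ↔ _
  rw [h]
  cases M.testBit v <;> simp

theorem piece (M v x b : ℕ) (hb : b = 2 ^ v) :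
    (Nat.rec (motive := fun _ => ℕ) 0 (fun _ _ => x) (Nat.land M b) : ℕ)
      = if M.testBit v = true then x else 0 := by
  subst hb
  rw [rec_eq]
  have h := and_pow_eq M v
  cases hv : M.testBit v <;> simp_all

theorem loop_eq (F : ℕ → ℕ) (M : ℕ) :
    loop F M = ((List.range 15).map fun v => if M.testBit v = true then F v else 0).sum := by
  have hr : List.range 15 = [0,1,2,3,4,5,6,7,8,9,10,11,12,13,14] := by decide
  rw [hr]
  unfold loop
  rw [piece M 0 _ _ (by norm_num), piece M 1 _ _ (by norm_num), piece M 2 _ _ (by norm_num),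
    piece M 3 _ _ (by norm_num), piece M 4 _ _ (by norm_num), piece M 5 _ _ (by norm_num),
    piece M 6 _ _ (by norm_num), piece M 7 _ _ (by norm_num), piece M 8 _ _ (by norm_num),
    piece M 9 _ _ (by norm_num), piece M 10 _ _ (by norm_num), piece M 11 _ _ (by norm_num),
    piece M 12 _ _ (by norm_num), piece M 13 _ _ (by norm_num), piece M 14 _ _ (by norm_num)]
  simp only [List.map_cons, List.map_nil, List.sum_cons, List.sum_nil, Nat.add_eq, add_zero]

/-- `g` is the reversal of `f`, and `f` only has bits below 15. -/
def Inv (f g : ℕ) : Prop :=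
  (∀ x, f.testBit x = true → x < 15) ∧
    ∀ x, g.testBit x = true ↔ (x ≤ 30 ∧ f.testBit (30 - x) = true)

theorem testBit_nxt {f v e : ℕ} (hv : f.testBit v = true) (he : f.testBit e = true) (hne : v ≠ e)
    (x : ℕ) : ((f ^^^ 2 ^ v) ^^^ 2 ^ e).testBit x = true ↔
      (f.testBit x = true ∧ x ≠ v ∧ x ≠ e) := by
  rw [Nat.testBit_xor, Nat.testBit_xor, Nat.testBit_two_pow, Nat.testBit_two_pow]
  by_cases h1 : v = x
  · subst h1
    simp [hv, Ne.symm hne]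
  · by_cases h2 : e = x
    · subst h2
      simp [he, h1]
    · simp [h1, h2, Ne.symm h1, Ne.symm h2]

theorem Inv.next {f g v e : ℕ} (h : Inv f g) (hv : f.testBit v = true) (he : f.testBit e = true)
    (hne : v ≠ e) :
    Inv ((f ^^^ 2 ^ v) ^^^ 2 ^ e) ((g ^^^ 2 ^ (30 - v)) ^^^ 2 ^ (30 - e)) := by
  have hv15 := h.1 v hv
  have he15 := h.1 e he
  have e1 : 30 - (30 - v) = v := by omega
  have e2 : 30 - (30 - e) = e := by omega
  have gv : g.testBit (30 - v) = true := (h.2 _).2 ⟨by omega, by rw [e1]; exact hv⟩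
  have ge : g.testBit (30 - e) = true := (h.2 _).2 ⟨by omega, by rw [e2]; exact he⟩
  refine ⟨fun x hx => h.1 x ((testBit_nxt hv he hne x).1 hx).1, fun x => ?_⟩
  rw [testBit_nxt gv ge (by omega), testBit_nxt hv he hne, h.2]
  constructor
  · rintro ⟨⟨a, b⟩, c, d⟩
    exact ⟨a, b, by omega, by omega⟩
  · rintro ⟨a, b, c, d⟩
    exact ⟨⟨a, b⟩, by omega, by omega⟩

theorem testBit_msk {k last f g : ℕ} (hk : 18 ≤ k) (hk2 : k ≤ 24) (hl : last < 15) (h : Inv f g)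
    (v : ℕ) : (msk k last f g).testBit v = true ↔
      (f.testBit v = true ∧ last + v ≤ k ∧ f.testBit (k - (last + v)) = true) := by
  have : msk k last f g = f &&& (g >>> (30 - (k - last))) := rfl
  rw [this, Nat.testBit_and, Nat.testBit_shiftRight, Bool.and_eq_true, h.2]
  constructor
  · rintro ⟨a, b, c⟩
    refine ⟨a, by omega, ?_⟩
    convert c using 2
    omega
  · rintro ⟨a, b, c⟩
    refine ⟨a, by omega, ?_⟩
    convert c using 2
    omega

theorem cnt_eq (k v0 : ℕ) (hk : 18 ≤ k) (hk2 : k ≤ 24) (d : ℕ) : ∀ (last f g R : ℕ),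
    last < 15 → Inv f g → cnt k v0 d last f g R = (gen k v0 d last f R).length := by
  induction d with
  | zero =>
    intro last f g R _ _
    change (Nat.rec (motive := fun _ => ℕ) 0 (fun _ _ => 1) (Nat.sub last v0) : ℕ) = _
    rw [rec_eq, gen]
    have : Nat.sub last v0 = last - v0 := rfl
    rw [this]
    split_ifs <;> first | rfl | omega
  | succ d ih =>
    intro last f g R hl hI
    have key : ∀ v, f.testBit v = true → last + v ≤ k → f.testBit (k - (last + v)) = true →
        stepc k last f g R (cnt k v0 d) v = if v + (v + last) = k then 0 else
          (gen k v0 d v ((f ^^^ 2 ^ v) ^^^ 2 ^ (k - (last + v))) (R - v)).length := by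
      intro v h1 h2 h3
      unfold stepc
      rw [brec_eq]
      have hb : (Nat.beq (Nat.add v (Nat.add v last)) k = true) ↔ v + (v + last) = k := by
        exact nbeq _ _
      by_cases hc : v + (v + last) = k
      · rw [if_pos (hb.2 hc), if_pos hc]
      · rw [if_neg (fun h => hc (hb.1 h)), if_neg hc]
        have hne : v ≠ k - (last + v) := by omega
        exact ih v _ _ _ (hI.1 v h1) (hI.next h1 h3 hne)
    have hloop : loop (stepc k last f g R (cnt k v0 d)) (msk k last f g) =
        ((List.range 15).map fun v => if (f.testBit v = true ∧ last + v ≤ k ∧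
          f.testBit (k - (last + v)) = true) ∧ v + (v + last) ≠ k then
          (gen k v0 d v ((f ^^^ 2 ^ v) ^^^ 2 ^ (k - (last + v))) (R - v)).length else 0).sum := by
      rw [loop_eq]
      congr 1
      refine List.map_congr_left fun v _ => ?_
      have hm := testBit_msk hk hk2 hl hI v
      by_cases hc : (msk k last f g).testBit v = true
      · rw [if_pos hc]
        have hc' := hm.1 hc
        rw [key v hc'.1 hc'.2.1 hc'.2.2]
        by_cases h4 : v + (v + last) = k
        · simp [h4]
        · simp [h4, hc']
      · rw [if_neg hc, if_neg (fun h => hc (hm.2 h.1))]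
    have hgen : (gen k v0 (d + 1) last f R).length =
        ((List.range 15).map fun v => if (f.testBit v = true ∧ last + v ≤ k ∧
          f.testBit (k - (last + v)) = true) ∧ v + (v + last) ≠ k ∧ (d = 1 → v = R) ∧
            (d = 2 → f.testBit (k - R) = true) then
          (gen k v0 d v ((f ^^^ 2 ^ v) ^^^ 2 ^ (k - (last + v))) (R - v)).length else 0).sum := by
      rw [gen, List.length_flatMap]
      congr 1
      refine List.map_congr_left fun v _ => ?_
      split_ifs <;> simp
    rw [hgen]
    change (Bool.rec (motive := fun _ => ℕ)
      (Bool.rec (motive := fun _ => ℕ) (loop (stepc k last f g R (cnt k v0 d)) (msk k last f g))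
        (Nat.rec (motive := fun _ => ℕ) 0
          (fun _ _ => loop (stepc k last f g R (cnt k v0 d)) (msk k last f g))
          (Nat.land 1 (Nat.shiftRight f (Nat.sub k R)))) (Nat.beq d 2))
      (Nat.rec (motive := fun _ => ℕ) 0 (fun _ _ => stepc k last f g R (cnt k v0 d) R)
        (Nat.land (msk k last f g) (Nat.pow 2 R))) (Nat.beq d 1) : ℕ) = _
    simp only [brec_eq, nbeq]
    rw [piece (msk k last f g) R _ (Nat.pow 2 R) rfl, rec_eq, hloop]
    by_cases d1 : d = 1
    · subst d1
      simp only [if_true, true_imp_iff]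
      have hm := testBit_msk hk hk2 hl hI R
      have hpt : (fun v => if (f.testBit v = true ∧ last + v ≤ k ∧
          f.testBit (k - (last + v)) = true) ∧ v + (v + last) ≠ k ∧ (v = R) ∧
            (1 = 2 → f.testBit (k - R) = true) then
          (gen k v0 1 v ((f ^^^ 2 ^ v) ^^^ 2 ^ (k - (last + v))) (R - v)).length else 0)
          = fun v => if v = R then (if (msk k last f g).testBit R = true then
            stepc k last f g R (cnt k v0 1) R else 0) else 0 := by
        funext v
        by_cases hv : v = R
        · subst hv
          rw [if_pos rfl]
          by_cases hc : (msk k last f g).testBit v = true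
          · have hc' := hm.1 hc
            rw [if_pos hc, key v hc'.1 hc'.2.1 hc'.2.2]
            by_cases h4 : v + (v + last) = k
            · simp [h4]
            · simp [h4, hc']
          · rw [if_neg hc, if_neg (fun h => hc (hm.2 h.1))]
        · rw [if_neg hv, if_neg (fun h => hv h.2.2.1)]
      rw [hpt]
      by_cases hc : (msk k last f g).testBit R = true
      · have hR : R < 15 := hI.1 R (hm.1 hc).1
        rw [if_pos hc]
        generalize stepc k last f g R (cnt k v0 1) R = X
        have hr : List.range 15 = [0,1,2,3,4,5,6,7,8,9,10,11,12,13,14] := by decide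
        rw [hr]
        interval_cases R <;> simp
      · simp [hc]
    · rw [if_neg d1]
      by_cases d2 : d = 2
      · subst d2
        rw [if_pos rfl]
        have hb : Nat.land 1 (Nat.shiftRight f (Nat.sub k R)) = 0 ↔ f.testBit (k - R) = false := by
          change 1 &&& (f >>> (k - R)) = 0 ↔ _
          simp [Nat.testBit]
        by_cases hc : f.testBit (k - R) = true
        · rw [if_neg (by rw [hb]; simp [hc])]
          simp [hc]
        · rw [if_pos (by rw [hb]; simpa using hc)]
          simp [hc]
      · rw [if_neg d2]
        simp [d1, d2]

/-- Consecutive vertex, edge, vertex triples of the list sum to `k`. -/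
def Magic (k : ℕ) : List ℕ → Prop
  | a :: e :: b :: t => a + e + b = k ∧ Magic k (b :: t)
  | _ => True

/-- Sum of the vertex labels other than the last, in a list edge, vertex, edge, vertex, … -/
def inner : List ℕ → ℕ
  | _ :: v :: a :: t => v + inner (a :: t)
  | _ => 0

theorem gen_sound (k v0 : ℕ) (d : ℕ) : ∀ (last f R : ℕ) (l : List ℕ), l ∈ gen k v0 d last f R →
    l.length = 2 * d ∧ Magic k (last :: l) ∧ l.Nodup ∧ (∀ x ∈ l, f.testBit x = true) ∧
      v0 < l.getLastD last := by
  induction d with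
  | zero =>
    intro last f R l hl
    rw [gen] at hl
    split_ifs at hl with h
    · simp at hl; subst hl; simp [Magic, h]
    · simp at hl
  | succ d ih =>
    intro last f R l hl
    rw [gen, List.mem_flatMap] at hl
    obtain ⟨v, _, hl⟩ := hl
    split_ifs at hl with h
    · obtain ⟨t, ht, rfl⟩ := List.mem_map.1 hl
      obtain ⟨⟨h1, h2, h3⟩, h4, -, -⟩ := h
      obtain ⟨a1, a2, a3, a4, a5⟩ := ih _ _ _ _ ht
      have hne : v ≠ k - (last + v) := by omega
      have a4' := fun x hx => (testBit_nxt h1 h3 hne x).1 (a4 x hx)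
      refine ⟨by simp [a1]; ring, ⟨by omega, a2⟩, ?_, ?_, ?_⟩
      · rw [List.nodup_cons, List.nodup_cons, List.mem_cons]
        refine ⟨?_, fun hx => (a4' _ hx).2.1 rfl, a3⟩
        rintro (hx | hx)
        · exact hne hx.symm
        · exact (a4' _ hx).2.2 rfl
      · intro x hx
        rw [List.mem_cons, List.mem_cons] at hx
        rcases hx with rfl | rfl | hx
        · exact h3
        · exact h1
        · exact (a4' x hx).1
      · rw [List.getLastD_cons, List.getLastD_cons]; exact a5
    · simp at hl

theorem gen_complete (k v0 : ℕ) (d : ℕ) : ∀ (last f R : ℕ) (l : List ℕ),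
    (∀ x, f.testBit x = true → x < 15) →
    l.length = 2 * d → Magic k (last :: l) → l.Nodup → (∀ x ∈ l, f.testBit x = true) →
      v0 < l.getLastD last → inner l = R → l ∈ gen k v0 d last f R := by
  induction d with
  | zero =>
    intro last f R l _ h1 _ _ _ h5 _
    have : l = [] := List.length_eq_zero_iff.1 (by omega)
    subst this
    rw [gen, if_pos (by simpa using h5)]
    simp
  | succ d ih =>
    intro last f R l hf h1 h2 h3 h4 h5 h6
    match l, h1 with
    | e :: v :: t, h1 =>
      obtain ⟨hs, hm⟩ := h2
      have he : e = k - (last + v) := by omega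
      rw [List.nodup_cons, List.nodup_cons, List.mem_cons, not_or] at h3
      have fe : f.testBit e = true := h4 e (by simp)
      have fv : f.testBit v = true := h4 v (by simp)
      have hne : v ≠ e := fun h => h3.1.1 h.symm
      have htl : t.length = 2 * d := by simp at h1; omega
      rw [gen, List.mem_flatMap]
      refine ⟨v, List.mem_range.2 (hf v fv), ?_⟩
      rw [← he, if_pos]
      · refine List.mem_map.2 ⟨t, ?_, rfl⟩
        apply ih
        · intro x hx
          exact hf x ((testBit_nxt fv fe hne x).1 hx).1
        · exact htl
        · exact hm
        · exact h3.2.2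
        · intro x hx
          rw [testBit_nxt fv fe hne]
          exact ⟨h4 x (by simp [hx]), fun h => h3.2.1 (h ▸ hx), fun h => h3.1.2 (h ▸ hx)⟩
        · rwa [List.getLastD_cons, List.getLastD_cons] at h5
        · match t with
          | [] => simp [inner] at h6 ⊢; omega
          | a :: s => simp only [inner] at h6 ⊢; omega
      · refine ⟨⟨fv, by omega, fe⟩, by omega, ?_, ?_⟩
        · rintro rfl
          match t, htl with
          | [a, b], _ => simpa [inner] using h6
        · rintro rfl
          match t, htl with
          | [a, b, c, e'], _ =>
            simp [inner] at h6
            simp [Magic] at hm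
            have : k - R = a := by omega
            rw [this]
            exact h4 a (by simp)

theorem gen_nodup (k v0 : ℕ) (d : ℕ) : ∀ (last f R : ℕ), (gen k v0 d last f R).Nodup := by
  induction d with
  | zero => intro last f R; rw [gen]; split_ifs <;> simp
  | succ d ih =>
    intro last f R
    rw [gen, List.nodup_flatMap]
    constructor
    · intro v _
      split_ifs
      · refine (ih _ _ _).map ?_
        intro a b hab
        simpa using hab
      · simp
    · refine List.nodup_range.imp ?_
      intro a b hab x hx hy
      dsimp only at hx hy
      split_ifs at hx hy <;> simp only [List.mem_map, List.not_mem_nil] at hx hy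
      obtain ⟨t, _, rfl⟩ := hx
      obtain ⟨t', _, h⟩ := hy
      simp at h
      exact hab h.2.1.symm

/-- All labelings with (0-based) magic constant `k`. -/
def genK (k : ℕ) : List (List ℕ) := (List.range 15).flatMap fun v =>
  (gen k v 7 v (32767 ^^^ 2 ^ v) (7 * k - 105)).map (fun t => v :: t)

theorem full_testBit (x : ℕ) : (32767 : ℕ).testBit x = true ↔ x < 15 := by
  have : (32767 : ℕ) = 2 ^ 15 - 1 := by norm_num
  rw [this, Nat.testBit_two_pow_sub_one]; simp

theorem init_testBit (v : ℕ) (hv : v < 15) (x : ℕ) :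
    (32767 ^^^ 2 ^ v : ℕ).testBit x = true ↔ x < 15 ∧ x ≠ v := by
  rw [Nat.testBit_xor, Nat.testBit_two_pow]
  have h := full_testBit x
  by_cases h1 : v = x
  · subst h1
    simp [h.2 hv]
  · simp [h1, h, Ne.symm h1]

theorem init_inv (v : ℕ) (hv : v < 15) :
    Inv (32767 ^^^ 2 ^ v) (2147418112 ^^^ 2 ^ (30 - v)) := by
  interval_cases v <;>
  · refine ⟨fun x hx => ((init_testBit _ (by norm_num) x).1 hx).1, fun x => ?_⟩
    by_cases h : x ≤ 30
    · interval_cases x <;> decide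
    · simp only [h, false_and, iff_false]
      rw [Nat.testBit_lt_two_pow]
      · simp
      · exact lt_of_lt_of_le (b := 2 ^ 31) (by decide) (Nat.pow_le_pow_right (by norm_num) (by omega))

theorem cntK_eq (k : ℕ) (hk : 18 ≤ k) (hk2 : k ≤ 24) : cntK k = (genK k).length := by
  unfold cntK genK
  rw [loop_eq, List.length_flatMap]
  congr 1
  refine List.map_congr_left fun v hv => ?_
  have hv' := List.mem_range.1 hv
  rw [if_pos ((full_testBit v).2 hv'), List.length_map]
  exact cnt_eq k v hk hk2 7 v _ _ _ hv' (init_inv v hv')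

theorem mem_genK {k : ℕ} {l : List ℕ} (h : l ∈ genK k) :
    l.length = 15 ∧ Magic k l ∧ l.Nodup ∧ (∀ x ∈ l, x < 15) ∧ l.headD 0 < l.getLastD 0 := by
  obtain ⟨v, hv, h⟩ := List.mem_flatMap.1 h
  obtain ⟨t, ht, rfl⟩ := List.mem_map.1 h
  have hv' := List.mem_range.1 hv
  obtain ⟨a1, a2, a3, a4, a5⟩ := gen_sound _ _ _ _ _ _ _ ht
  have a4' := fun x hx => (init_testBit v hv' x).1 (a4 x hx)
  refine ⟨by simp [a1], a2, ?_, ?_, ?_⟩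
  · exact List.nodup_cons.2 ⟨fun hx => (a4' v hx).2 rfl, a3⟩
  · intro x hx
    rcases List.mem_cons.1 hx with rfl | hx
    · exact hv'
    · exact (a4' x hx).1
  · rw [List.getLastD_cons]; exact a5

theorem genK_nodup (k : ℕ) : (genK k).Nodup := by
  rw [genK, List.nodup_flatMap]
  constructor
  · intro v _
    refine (gen_nodup _ _ _ _ _ _).map ?_
    intro a b hab
    simpa using hab
  · refine List.nodup_range.imp ?_
    intro a b hab x hx hy
    simp only [List.mem_map] at hx hy
    obtain ⟨t, _, rfl⟩ := hx
    obtain ⟨t', _, h⟩ := hy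
    simp at h
    exact hab h.1.symm

/-- All labelings. -/
def genAll : List (List ℕ) := (List.range 7).flatMap fun j => genK (18 + j)

theorem genAll_nodup : genAll.Nodup := by
  rw [genAll, List.nodup_flatMap]
  refine ⟨fun j _ => genK_nodup _, List.nodup_range.imp ?_⟩
  intro a b hab x hx hy
  obtain ⟨h1, h2, -⟩ := mem_genK hx
  obtain ⟨-, h3, -⟩ := mem_genK hy
  match x, h1 with
  | p :: q :: r :: t, _ =>
    have e1 := h2.1
    have e2 := h3.1
    omega

theorem ofFn15 (h : Fin 15 → ℕ) : List.ofFn h =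
    [h 0, h 1, h 2, h 3, h 4, h 5, h 6, h 7, h 8, h 9, h 10, h 11, h 12, h 13, h 14] := rfl

set_option maxRecDepth 100000
theorem c18 : cntK 18 = 272 := by decide +kernel
theorem c19 : cntK 19 = 480 := by decide +kernel
theorem c20 : cntK 20 = 872 := by decide +kernel
theorem c21 : cntK 21 = 2096 := by decide +kernel
theorem c22 : cntK 22 = 872 := by decide +kernel
theorem c23 : cntK 23 = 480 := by decide +kernel
theorem c24 : cntK 24 = 272 := by decide +kernel

theorem length_aux (G : ℕ → List (List ℕ)) (h0 : (G 0).length = 272) (h1 : (G 1).length = 480)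
    (h2 : (G 2).length = 872) (h3 : (G 3).length = 2096) (h4 : (G 4).length = 872)
    (h5 : (G 5).length = 480) (h6 : (G 6).length = 272) :
    ((List.range 7).flatMap G).length = 5344 := by
  have hr : List.range 7 = [0,1,2,3,4,5,6] := by decide
  rw [List.length_flatMap, hr]
  simp only [List.map_cons, List.map_nil, List.sum_cons, List.sum_nil, h0, h1, h2, h3, h4, h5, h6]
  norm_num

theorem length_genK (k j c : ℕ) (hk : 18 + j = k) (hj : j < 7) (h : cntK k = c) :
    (genK (18 + j)).length = c := by
  rw [hk, ← h]
  exact (cntK_eq k (by omega) (by omega)).symm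

theorem genAll_length : genAll.length = 5344 :=
  length_aux (fun j => genK (18 + j))
    (length_genK 18 0 272 rfl (by norm_num) c18) (length_genK 19 1 480 rfl (by norm_num) c19)
    (length_genK 20 2 872 rfl (by norm_num) c20) (length_genK 21 3 2096 rfl (by norm_num) c21)
    (length_genK 22 4 872 rfl (by norm_num) c22) (length_genK 23 5 480 rfl (by norm_num) c23)
    (length_genK 24 6 272 rfl (by norm_num) c24)

theorem sum15 (h : Fin 15 → ℕ) : ∑ i, h i =
    h 0 + h 1 + h 2 + h 3 + h 4 + h 5 + h 6 + h 7 + h 8 + h 9 + h 10 + h 11 + h 12 + h 13 + h 14 := by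
  rw [← List.sum_ofFn, ofFn15]
  simp only [List.sum_cons, List.sum_nil]
  omega

theorem perm_sum (σ : Equiv.Perm (Fin 15)) (w : ℕ → ℕ) :
    ∑ i : Fin 15, w (σ i).val = ∑ i : Fin 15, w i.val :=
  Equiv.sum_comp σ (fun i => w i.val)

end EMTL

open EMTL in
/-- The number of edge-magic total labelings of the path `P 7`, counted up to the
reversal symmetry of the path, is `5344`. -/
theorem pathEMTLCountUpToRev_P7 : pathEMTLCountUpToRev 7 = 5344 := by
  classical
  rw [← genAll_length, ← List.toFinset_card_of_nodup genAll_nodup]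
  unfold pathEMTLCountUpToRev
  refine Finset.card_bij (fun σ _ => List.ofFn (fun i : Fin 15 => (σ i).val)) ?_ ?_ ?_
  · intro σ hσ
    obtain ⟨⟨k, hk⟩, hlt⟩ := (Finset.mem_filter.1 hσ).2
    have q0 : (σ (0 : Fin 15)).val + 1 + ((σ (1 : Fin 15)).val + 1) + ((σ (2 : Fin 15)).val + 1) = k := hk 0
    have q1 : (σ (2 : Fin 15)).val + 1 + ((σ (3 : Fin 15)).val + 1) + ((σ (4 : Fin 15)).val + 1) = k := hk 1
    have q2 : (σ (4 : Fin 15)).val + 1 + ((σ (5 : Fin 15)).val + 1) + ((σ (6 : Fin 15)).val + 1) = k := hk 2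
    have q3 : (σ (6 : Fin 15)).val + 1 + ((σ (7 : Fin 15)).val + 1) + ((σ (8 : Fin 15)).val + 1) = k := hk 3
    have q4 : (σ (8 : Fin 15)).val + 1 + ((σ (9 : Fin 15)).val + 1) + ((σ (10 : Fin 15)).val + 1) = k := hk 4
    have q5 : (σ (10 : Fin 15)).val + 1 + ((σ (11 : Fin 15)).val + 1) + ((σ (12 : Fin 15)).val + 1) = k := hk 5
    have q6 : (σ (12 : Fin 15)).val + 1 + ((σ (13 : Fin 15)).val + 1) + ((σ (14 : Fin 15)).val + 1) = k := hk 6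
    have hlt' : (σ (0 : Fin 15)).val < (σ (14 : Fin 15)).val := hlt
    have hnd : (List.ofFn (fun i : Fin 15 => (σ i).val)).Nodup :=
      List.nodup_ofFn.2 (Fin.val_injective.comp σ.injective)
    have hbd : ∀ x ∈ List.ofFn (fun i : Fin 15 => (σ i).val), x < 15 := by
      intro x hx
      obtain ⟨i, rfl⟩ := (List.mem_ofFn' _ _).1 hx
      exact (σ i).isLt
    have hsum : ∑ i : Fin 15, (σ i).val = 105 := by
      rw [perm_sum σ (fun x => x)]; decide
    have hlow : ∑ i : Fin 15, (5 - (σ i).val) = 15 := by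
      rw [perm_sum σ (fun x => 5 - x)]; decide
    have hupp : ∑ i : Fin 15, ((σ i).val - 9) = 15 := by
      rw [perm_sum σ (fun x => x - 9)]; decide
    rw [sum15] at hsum hlow hupp
    -- bounds on the inner sum
    have hin : 15 ≤ (σ (2 : Fin 15)).val + (σ (4 : Fin 15)).val + (σ (6 : Fin 15)).val +
        (σ (8 : Fin 15)).val + (σ (10 : Fin 15)).val + (σ (12 : Fin 15)).val ∧
        (σ (2 : Fin 15)).val + (σ (4 : Fin 15)).val + (σ (6 : Fin 15)).val +
        (σ (8 : Fin 15)).val + (σ (10 : Fin 15)).val + (σ (12 : Fin 15)).val ≤ 69 := by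
      have l1 : ∀ i : Fin 15, 5 ≤ (σ i).val + (5 - (σ i).val) := fun i => by omega
      have l2 : ∀ i : Fin 15, (σ i).val ≤ 9 + ((σ i).val - 9) := fun i => by omega
      have a2 := l1 2
      have a4 := l1 4
      have a6 := l1 6
      have a8 := l1 8
      have a10 := l1 10
      have a12 := l1 12
      have b2 := l2 2
      have b4 := l2 4
      have b6 := l2 6
      have b8 := l2 8
      have b10 := l2 10
      have b12 := l2 12
      clear l1 l2
      constructor
      · clear hupp
        generalize hA : (fun i : Fin 15 => 5 - (σ i).val) = A at *
        have hA' : ∀ i, 5 - (σ i).val = A i := fun i => congrFun hA i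
        simp only [hA'] at *
        linarith [Nat.zero_le (A 0), Nat.zero_le (A 1), Nat.zero_le (A 3), Nat.zero_le (A 5), Nat.zero_le (A 7), Nat.zero_le (A 9), Nat.zero_le (A 11), Nat.zero_le (A 13), Nat.zero_le (A 14)]
      · clear hlow
        generalize hA : (fun i : Fin 15 => (σ i).val - 9) = A at *
        have hA' : ∀ i, (σ i).val - 9 = A i := fun i => congrFun hA i
        simp only [hA'] at *
        linarith [Nat.zero_le (A 0), Nat.zero_le (A 1), Nat.zero_le (A 3), Nat.zero_le (A 5), Nat.zero_le (A 7), Nat.zero_le (A 9), Nat.zero_le (A 11), Nat.zero_le (A 13), Nat.zero_le (A 14)]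
    rw [ofFn15] at hnd hbd
    rw [ofFn15]
    clear hk hlt hσ hlow hupp
    generalize (σ (0 : Fin 15)).val = x0 at *
    generalize (σ (1 : Fin 15)).val = x1 at *
    generalize (σ (2 : Fin 15)).val = x2 at *
    generalize (σ (3 : Fin 15)).val = x3 at *
    generalize (σ (4 : Fin 15)).val = x4 at *
    generalize (σ (5 : Fin 15)).val = x5 at *
    generalize (σ (6 : Fin 15)).val = x6 at *
    generalize (σ (7 : Fin 15)).val = x7 at *
    generalize (σ (8 : Fin 15)).val = x8 at *
    generalize (σ (9 : Fin 15)).val = x9 at *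
    generalize (σ (10 : Fin 15)).val = x10 at *
    generalize (σ (11 : Fin 15)).val = x11 at *
    generalize (σ (12 : Fin 15)).val = x12 at *
    generalize (σ (13 : Fin 15)).val = x13 at *
    generalize (σ (14 : Fin 15)).val = x14 at *
    rw [List.mem_toFinset, genAll, List.mem_flatMap]
    refine ⟨k - 21, List.mem_range.2 (by omega), ?_⟩
    have hx0 : x0 < 15 := hbd x0 (by simp)
    rw [genK, List.mem_flatMap]
    refine ⟨x0, List.mem_range.2 hx0, List.mem_map.2 ⟨_, ?_, rfl⟩⟩
    rw [List.nodup_cons] at hnd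
    apply gen_complete
    · exact fun x hx => ((init_testBit x0 hx0 x).1 hx).1
    · rfl
    · simp only [Magic, and_true]
      omega
    · exact hnd.2
    · intro x hx
      rw [init_testBit x0 hx0]
      exact ⟨hbd x (List.mem_cons_of_mem _ hx), fun h => hnd.1 (h ▸ hx)⟩
    · simpa using hlt'
    · simp only [EMTL.inner]
      omega
  · intro σ _ τ _ h
    have h' := List.ofFn_injective h
    ext i
    exact congrFun h' i
  · intro l hl
    rw [List.mem_toFinset, genAll, List.mem_flatMap] at hl
    obtain ⟨j, -, hl⟩ := hl
    obtain ⟨h1, h2, h3, h4, h5⟩ := mem_genK hl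
    let φ : Fin 15 → Fin 15 := fun i => ⟨l[i.val]'(by omega), h4 _ (List.getElem_mem _)⟩
    have hφ : Function.Injective φ := by
      intro a b hab
      have : l[a.val]'(by omega) = l[b.val]'(by omega) := congrArg Fin.val hab
      exact Fin.ext ((h3.getElem_inj_iff).1 this)
    let σ : Equiv.Perm (Fin 15) := Equiv.ofBijective φ (Finite.injective_iff_bijective.1 hφ)
    have hσl : List.ofFn (fun i : Fin 15 => (σ i).val) = l := by
      apply List.ext_getElem
      · simp [h1]
      · intro i _ _
        rw [List.getElem_ofFn]
        rfl
    refine ⟨σ, ?_, hσl⟩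
    rw [← hσl, ofFn15] at h2 h5
    simp only [Magic, and_true] at h2
    refine Finset.mem_filter.2 ⟨Finset.mem_univ _, ⟨18 + j + 3, ?_⟩, ?_⟩
    · obtain ⟨q0, q1, q2, q3, q4, q5, q6⟩ := h2
      have aux : ∀ {a b c k : ℕ}, a + b + c = k → (a + 1) + (b + 1) + (c + 1) = k + 3 := by
        intros; omega
      intro i
      fin_cases i
      · exact aux q0
      · exact aux q1
      · exact aux q2
      · exact aux q3
      · exact aux q4
      · exact aux q5
      · exact aux q6
    · exact h5
end

section
/- The number of edge-magic total labelings of the path P_8 (the path with 9 vertices and 8 edges), counted up to the reversal symmetry of the path, is 23408. -/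
namespace EM

/-- Evaluate `x` before passing it on (only matters for the efficiency of kernel evaluation). -/
noncomputable def force (x : ℕ) (k : ℕ → ℕ) : ℕ :=
  Nat.rec (motive := fun _ => ℕ) (k 0) (fun p _ => k (Nat.succ p)) x

/-- Sum of `f v` over the set bits `v` of a mask, with fuel `n`. -/
noncomputable def loop (f : ℕ → ℕ) (n : ℕ) : ℕ → ℕ :=
  Nat.rec (motive := fun _ => ℕ → ℕ) (fun _ => 0)
    (fun _ ih m => Nat.rec (motive := fun _ => ℕ) 0
      (fun p _ => force (Nat.log2 (Nat.succ p)) fun v =>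
       Nat.add (f v) (ih (Nat.xor (Nat.succ p) (Nat.pow 2 v)))) m) n

/-- Choose a new vertex label `v` and the edge label `K - last - v` among the free labels.
`A` is the mask of free labels, `R` the reversed mask (bit `32 - x` for label `x`),
`M` a mask of candidates. -/
noncomputable def step (K last A R M : ℕ) (f : ℕ → ℕ → ℕ → ℕ) : ℕ :=
  loop (fun v => Bool.rec (motive := fun _ => ℕ)
     (force (Nat.xor A (Nat.xor (Nat.pow 2 v) (Nat.pow 2 (Nat.sub K (Nat.add last v))))) fun A' =>
     force (Nat.xor R (Nat.xor (Nat.pow 2 (Nat.sub 32 v))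
        (Nat.pow 2 (Nat.sub (Nat.add 32 (Nat.add last v)) K)))) fun R' =>
      f v A' R') 0 (Nat.beq (Nat.add last (Nat.add v v)) K)) 17
    (Nat.land M (Nat.land A (Nat.shiftRight R (Nat.sub (Nat.add 32 last) K))))

/-- The two end vertices. -/
noncomputable def fin1 (K v1 last A R : ℕ) : ℕ :=
  step K v1 A R 131071 (fun v0 A' R' => step K last A' R' 131071 (fun v8 _ _ =>
   Bool.rec (motive := fun _ => ℕ) 1 0 (Nat.ble v8 v0)))

/-- Pruning mask. -/
noncomputable def pmask (K n A R s : ℕ) : ℕ :=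
  Nat.rec (motive := fun _ => ℕ) (Nat.pow 2 s)
    (fun n _ => Nat.rec (motive := fun _ => ℕ) (Nat.shiftRight R (Nat.sub 32 s))
      (fun n _ => Nat.rec (motive := fun _ => ℕ)
         (Nat.shiftLeft (Nat.shiftRight A (Nat.sub K s)) (Nat.sub s K))
         (fun _ _ => 131071) n) n) n

/-- The search through the inner vertices; `n` inner vertices, of label sum `s`, are left. -/
noncomputable def dfs (K v1 n : ℕ) : ℕ → ℕ → ℕ → ℕ → ℕ :=
  Nat.rec (motive := fun _ => ℕ → ℕ → ℕ → ℕ → ℕ) (fun _ last A R => fin1 K v1 last A R)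
    (fun n ih s last A R =>
      step K last A R (pmask K n A R s) fun v A' R' =>
       Bool.rec (motive := fun _ => ℕ) 0 (force (Nat.sub s v) fun s' => ih s' v A' R')
        (Nat.ble v s)) n

noncomputable def top (K I v1 : ℕ) : ℕ :=
  Bool.rec (motive := fun _ => ℕ) 0
   (force (Nat.sub I v1) fun s => force (Nat.xor 131071 (Nat.pow 2 v1)) fun A =>
    force (Nat.xor 8589869056 (Nat.pow 2 (Nat.sub 32 v1))) fun R => dfs K v1 6 s v1 A R)
   (Nat.ble v1 I)

noncomputable def total (K I : ℕ) : ℕ := loop (fun v => top K I v) 17 131071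
theorem force_eq (x : ℕ) (k : ℕ → ℕ) : force x k = k x := by
  cases x <;> rfl

theorem loop_eq (f : ℕ → ℕ) (n : ℕ) : ∀ m N, m < 2 ^ n → n ≤ N →
    loop f n m = ∑ v ∈ Finset.range N, if m.testBit v = true then f v else 0 := by
  induction n with
  | zero =>
    intro m N hm _
    have : m = 0 := by simpa using hm
    subst this
    simp [loop]
  | succ n ih =>
    intro m N hm hN
    rcases m with _ | p
    · simp [loop]
    · have h1 : loop f (n+1) (p+1) = force (Nat.log2 (p+1)) fun v =>
          f v + loop f n ((p+1) ^^^ (2 ^ v)) := rfl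
      rw [h1, force_eq]
      set v := Nat.log2 (p+1) with hv
      have hvn : v < n + 1 := (Nat.log2_lt (by omega)).2 hm
      have hbit : (p+1).testBit v = true := Nat.testBit_log2 (by omega)
      have hlt : (p+1) < 2 ^ (v+1) := Nat.lt_log2_self
      have hm' : (p+1) ^^^ (2^v) < 2 ^ n := by
        refine lt_of_lt_of_le (b := 2^v) ?_ (Nat.pow_le_pow_right (by omega) (by omega))
        apply Nat.lt_pow_two_of_testBit
        intro i hi
        rw [Nat.testBit_xor, Nat.testBit_two_pow]
        rcases Nat.eq_or_lt_of_le hi with h | h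
        · subst h; simp [hbit]
        · have : (p+1).testBit i = false :=
            Nat.testBit_lt_two_pow (lt_of_lt_of_le hlt (Nat.pow_le_pow_right (by omega) h))
          simp [this]; omega
      rw [ih _ N hm' (by omega)]
      have hmem : v ∈ Finset.range N := by simp; omega
      rw [← Finset.add_sum_erase _ _ hmem, ← Finset.add_sum_erase (Finset.range N)
        (fun w => if (p+1).testBit w = true then f w else 0) hmem]
      simp only [hbit, Nat.testBit_xor, Nat.testBit_two_pow]
      simp only [decide_true, Bool.xor_self, if_true, Bool.false_eq_true, if_false, zero_add]
      congr 1
      apply Finset.sum_congr rfl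
      intro w hw
      have : v ≠ w := fun h => (Finset.ne_of_mem_erase hw) h.symm
      simp [this]

/-- Label (minus one) of the element at position `t`. -/
def val (σ : Equiv.Perm (Fin 17)) (t : ℕ) : ℕ := if h : t < 17 then (σ ⟨t, h⟩).val else 0

theorem val_lt (σ : Equiv.Perm (Fin 17)) (t : ℕ) : val σ t < 17 := by
  unfold val; split
  · exact (σ _).isLt
  · omega

theorem val_inj (σ : Equiv.Perm (Fin 17)) {t u : ℕ} (ht : t < 17) (hu : u < 17)
    (h : val σ t = val σ u) : t = u := by
  simp only [val, ht, hu, dif_pos] at h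
  have := σ.injective (Fin.ext h)
  simpa using this

def Valid (K : ℕ) (σ : Equiv.Perm (Fin 17)) : Prop :=
  (∀ i < 8, val σ (2*i) + val σ (2*i+1) + val σ (2*i+2) = K) ∧ val σ 0 < val σ 16

open Classical in
/-- Valid labelings which agree with `p` on `D`. -/
noncomputable def F (K : ℕ) (D : Finset ℕ) (p : ℕ → ℕ) : Finset (Equiv.Perm (Fin 17)) :=
  Finset.univ.filter fun σ => Valid K σ ∧ ∀ t ∈ D, val σ t = p t

theorem mem_F {K : ℕ} {D : Finset ℕ} {p : ℕ → ℕ} {σ : Equiv.Perm (Fin 17)} :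
    σ ∈ F K D p ↔ Valid K σ ∧ ∀ t ∈ D, val σ t = p t := by
  simp [F]

structure St (K : ℕ) (D : Finset ℕ) (p : ℕ → ℕ) (A R : ℕ) : Prop where
  dom : ∀ t ∈ D, t < 17
  edge : ∀ i, 2*i+1 ∈ D → 2*i ∈ D ∧ 2*i+2 ∈ D ∧ p (2*i) + p (2*i+1) + p (2*i+2) = K
  lt : ∀ t ∈ D, p t < 17
  inj : ∀ t ∈ D, ∀ u ∈ D, p t = p u → t = u
  hA : ∀ x, A.testBit x = true ↔ x < 17 ∧ ∀ t ∈ D, p t ≠ x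
  hR : ∀ x, R.testBit x = true ↔ x ≤ 32 ∧ A.testBit (32 - x) = true

theorem St.free {K D p A R} (h : St K D p A R) {σ} (hσ : σ ∈ F K D p) {t : ℕ} (ht : t < 17)
    (htD : t ∉ D) : A.testBit (val σ t) = true := by
  rw [h.hA]
  refine ⟨val_lt _ _, fun u hu he => htD ?_⟩
  rw [← (mem_F.1 hσ).2 u hu] at he
  rw [← val_inj σ (h.dom u hu) ht he]; exact hu

def upd (p : ℕ → ℕ) (b c e v : ℕ) : ℕ → ℕ := fun t => if t = c then v else if t = b then e else p t

theorem St.extend {K D p A R} (h : St K D p A R) {i a c v e : ℕ} (hi : i < 8)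
    (hac : (a = 2*i ∧ c = 2*i+2) ∨ (a = 2*i+2 ∧ c = 2*i))
    (haD : a ∈ D) (hbD : 2*i+1 ∉ D) (hcD : c ∉ D)
    (hv : A.testBit v = true) (he : A.testBit e = true) (hK : p a + v + e = K) (hve : v ≠ e) :
    St K (insert (2*i+1) (insert c D)) (upd p (2*i+1) c e v)
      (A ^^^ (2^v ^^^ 2^e)) (R ^^^ (2^(32-v) ^^^ 2^(32-e))) := by
  have hv' := (h.hA v).1 hv
  have he' := (h.hA e).1 he
  have hbc : 2*i+1 ≠ c := by omega
  have hb : upd p (2*i+1) c e v (2*i+1) = e := by simp [upd, hbc]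
  have hc : upd p (2*i+1) c e v c = v := by simp [upd]
  have ho : ∀ t ∈ D, upd p (2*i+1) c e v t = p t := by
    intro t ht
    have h1 : t ≠ c := fun h => hcD (h ▸ ht)
    have h2 : t ≠ 2*i+1 := fun h => hbD (h ▸ ht)
    simp [upd, h1, h2]
  have hA' : ∀ x, (A ^^^ (2^v ^^^ 2^e)).testBit x = true ↔ A.testBit x = true ∧ x ≠ v ∧ x ≠ e := by
    intro x
    rw [Nat.testBit_xor, Nat.testBit_xor, Nat.testBit_two_pow, Nat.testBit_two_pow]
    by_cases h1 : x = v
    · subst h1; simp [hv, Ne.symm hve]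
    · by_cases h2 : x = e
      · subst h2; simp [he, hve]
      · simp [h1, h2, Ne.symm h1, Ne.symm h2]
  refine ⟨?_, ?_, ?_, ?_, ?_, ?_⟩
  · intro t ht
    simp only [Finset.mem_insert] at ht
    rcases ht with ht | ht | ht
    · omega
    · omega
    · exact h.dom t ht
  · intro k hk
    simp only [Finset.mem_insert] at hk
    rcases hk with hk | hk | hk
    · have : k = i := by omega
      subst this
      rcases hac with ⟨rfl, rfl⟩ | ⟨rfl, rfl⟩
      · refine ⟨by simp [haD], by simp, ?_⟩
        rw [hb, hc, ho _ haD]; omega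
      · refine ⟨by simp, by simp [haD], ?_⟩
        rw [hb, hc, ho _ haD]; omega
    · omega
    · obtain ⟨h1, h2, h3⟩ := h.edge k hk
      refine ⟨by simp [h1], by simp [h2], ?_⟩
      rw [ho _ h1, ho _ h2, ho _ hk]; exact h3
  · intro t ht
    simp only [Finset.mem_insert] at ht
    rcases ht with rfl | rfl | ht
    · rw [hb]; exact he'.1
    · rw [hc]; exact hv'.1
    · rw [ho t ht]; exact h.lt t ht
  · intro t ht u hu heq
    simp only [Finset.mem_insert] at ht hu
    rcases ht with rfl | rfl | ht <;> rcases hu with rfl | rfl | hu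
    · rfl
    · rw [hb, hc] at heq; exact absurd heq.symm hve
    · rw [hb, ho u hu] at heq; exact absurd heq.symm (he'.2 u hu)
    · rw [hb, hc] at heq; exact absurd heq hve
    · rfl
    · rw [hc, ho u hu] at heq; exact absurd heq.symm (hv'.2 u hu)
    · rw [hb, ho t ht] at heq; exact absurd heq (he'.2 t ht)
    · rw [hc, ho t ht] at heq; exact absurd heq (hv'.2 t ht)
    · rw [ho t ht, ho u hu] at heq; exact h.inj t ht u hu heq
  · intro x
    rw [hA', h.hA]
    constructor
    · rintro ⟨⟨h1, h2⟩, h3, h4⟩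
      refine ⟨h1, fun t ht => ?_⟩
      simp only [Finset.mem_insert] at ht
      rcases ht with rfl | rfl | ht
      · rw [hb]; exact h4.symm
      · rw [hc]; exact h3.symm
      · rw [ho t ht]; exact h2 t ht
    · rintro ⟨h1, h2⟩
      refine ⟨⟨h1, fun t ht => ?_⟩, ?_, ?_⟩
      · rw [← ho t ht]; exact h2 t (by simp [ht])
      · rw [← hc]; exact (h2 c (by simp)).symm
      · have := h2 (2*i+1) (by simp)
        rw [hb] at this; exact this.symm
  · intro x
    rw [hA', Nat.testBit_xor, Nat.testBit_xor, Nat.testBit_two_pow, Nat.testBit_two_pow]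
    have hv1 := hv'.1
    have he1 := he'.1
    have hRv : R.testBit (32 - v) = true := by
      rw [h.hR]; refine ⟨by omega, ?_⟩
      rw [show 32 - (32 - v) = v by omega]; exact hv
    have hRe : R.testBit (32 - e) = true := by
      rw [h.hR]; refine ⟨by omega, ?_⟩
      rw [show 32 - (32 - e) = e by omega]; exact he
    by_cases h1 : x = 32 - v
    · subst h1
      have h3 : 32 - e ≠ 32 - v := by omega
      have h4 : 32 - (32 - v) = v := by omega
      simp [hRv, h3, h4]
    · by_cases h2 : x = 32 - e
      · subst h2
        have h3 : 32 - v ≠ 32 - e := by omega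
        have h4 : 32 - (32 - e) = e := by omega
        simp [hRe, h3, h4]
      · have := h.hR x
        simp only [Ne.symm h1, Ne.symm h2, decide_false, Bool.xor_false, this]
        constructor
        · rintro ⟨h3, h4⟩; exact ⟨h3, h4, by omega, by omega⟩
        · rintro ⟨h3, h4, _⟩; exact ⟨h3, h4⟩

theorem step_eq {K D p A R} (h : St K D p A R) {i a c M : ℕ} (hK : K ≤ 31) (hi : i < 8)
    (hac : (a = 2*i ∧ c = 2*i+2) ∨ (a = 2*i+2 ∧ c = 2*i))
    (haD : a ∈ D) (hbD : 2*i+1 ∉ D) (hcD : c ∉ D)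
    (hM : ∀ σ ∈ F K D p, M.testBit (val σ c) = true)
    (f : ℕ → ℕ → ℕ → ℕ)
    (hf : ∀ v e A' R', p a + v + e = K →
      St K (insert (2*i+1) (insert c D)) (upd p (2*i+1) c e v) A' R' →
      f v A' R' = (F K (insert (2*i+1) (insert c D)) (upd p (2*i+1) c e v)).card) :
    step K (p a) A R M f = (F K D p).card := by
  have hpa := h.lt a haD
  set m := M &&& (A &&& (R >>> (32 + p a - K))) with hm
  have hbit : ∀ v, m.testBit v = true ↔ M.testBit v = true ∧ A.testBit v = true ∧
      p a + v ≤ K ∧ A.testBit (K - (p a + v)) = true := by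
    intro v
    rw [hm, Nat.testBit_and, Nat.testBit_and, Nat.testBit_shiftRight, Bool.and_eq_true,
      Bool.and_eq_true, h.hR]
    constructor
    · rintro ⟨h1, h2, h3, h4⟩
      refine ⟨h1, h2, by omega, ?_⟩
      rw [show K - (p a + v) = 32 - (32 + p a - K + v) by omega]; exact h4
    · rintro ⟨h1, h2, h3, h4⟩
      refine ⟨h1, h2, by omega, ?_⟩
      rw [show 32 - (32 + p a - K + v) = K - (p a + v) by omega]; exact h4
  have hmlt : m < 2 ^ 17 := by
    apply Nat.lt_pow_two_of_testBit
    intro j hj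
    by_contra hc
    have := ((h.hA j).1 ((hbit j).1 (by simpa using hc)).2.1).1
    omega
  have h1 : step K (p a) A R M f = loop (fun v => Bool.rec (motive := fun _ => ℕ)
     (force (A ^^^ (2^v ^^^ 2^(K - (p a + v)))) fun A' =>
     force (R ^^^ (2^(32-v) ^^^ 2^(32 + (p a + v) - K))) fun R' =>
      f v A' R') 0 (Nat.beq (p a + (v + v)) K)) 17 m := rfl
  rw [h1, loop_eq _ 17 m 17 hmlt le_rfl]
  have h2 : (F K D p).card = ∑ v ∈ Finset.range 17, ((F K D p).filter fun σ => val σ c = v).card :=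
    Finset.card_eq_sum_card_fiberwise (f := fun σ => val σ c)
      (fun σ _ => by simpa using val_lt σ c)
  rw [h2]
  apply Finset.sum_congr rfl
  intro v _
  -- facts about members of the fibre
  have hfib : ∀ σ ∈ F K D p, val σ c = v → p a + v + val σ (2*i+1) = K ∧
      A.testBit v = true ∧ A.testBit (val σ (2*i+1)) = true ∧ v ≠ val σ (2*i+1) := by
    intro σ hσ hv
    have hval := (mem_F.1 hσ).1.1 i hi
    have ha := (mem_F.1 hσ).2 a haD
    refine ⟨?_, ?_, ?_, ?_⟩
    · rcases hac with ⟨rfl, rfl⟩ | ⟨rfl, rfl⟩ <;> omega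
    · rw [← hv]; exact h.free hσ (by omega) hcD
    · exact h.free hσ (by omega) hbD
    · intro he
      rw [← hv] at he
      have := val_inj σ (by omega) (by omega) he
      omega
  by_cases hb : m.testBit v = true
  · rw [if_pos hb]
    obtain ⟨b1, b2, b3, b4⟩ := (hbit v).1 hb
    by_cases hve : p a + (v + v) = K
    · rw [show Nat.beq (p a + (v + v)) K = true from (by rw [Nat.beq_eq]; exact hve)]
      symm
      rw [Finset.card_eq_zero, Finset.filter_eq_empty_iff]
      intro σ hσ hv
      obtain ⟨f1, f2, f3, f4⟩ := hfib σ hσ hv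
      omega
    · have hbf : Nat.beq (p a + (v + v)) K = false := by
        rw [Bool.eq_false_iff]; exact fun h => hve (Nat.eq_of_beq_eq_true h)
      rw [hbf]
      simp only [force_eq]
      have hle := ((h.hA _).1 b4).1
      rw [show 32 + (p a + v) - K = 32 - (K - (p a + v)) by omega]
      rw [hf v (K - (p a + v)) _ _ (by omega)
        (h.extend hi hac haD hbD hcD b2 b4 (by omega) (by omega))]
      congr 1
      ext σ
      simp only [Finset.mem_filter, mem_F, Finset.mem_insert]
      constructor
      · rintro ⟨g1, g2⟩
        have hbc : 2*i+1 ≠ c := by omega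
        refine ⟨⟨g1, fun t ht => ?_⟩, ?_⟩
        · rw [g2 t (Or.inr (Or.inr ht))]
          have h1 : t ≠ c := fun h => hcD (h ▸ ht)
          have h2 : t ≠ 2*i+1 := fun h => hbD (h ▸ ht)
          simp [upd, h1, h2]
        · rw [g2 c (Or.inr (Or.inl rfl))]; simp [upd]
      · rintro ⟨⟨g1, g2⟩, g3⟩
        obtain ⟨f1, f2, f3, f4⟩ := hfib σ (mem_F.2 ⟨g1, g2⟩) g3
        refine ⟨g1, fun t ht => ?_⟩
        have hbc : 2*i+1 ≠ c := by omega
        rcases ht with rfl | rfl | ht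
        · simp only [upd, hbc, if_false, if_true]; omega
        · simp [upd, g3]
        · have h1 : t ≠ c := fun h => hcD (h ▸ ht)
          have h2 : t ≠ 2*i+1 := fun h => hbD (h ▸ ht)
          simp [upd, h1, h2, g2 t ht]
  · rw [if_neg hb]
    symm
    rw [Finset.card_eq_zero, Finset.filter_eq_empty_iff]
    intro σ hσ hv
    obtain ⟨f1, f2, f3, f4⟩ := hfib σ hσ hv
    apply hb
    rw [hbit]
    refine ⟨hv ▸ hM σ hσ, f2, by omega, ?_⟩
    rw [show K - (p a + v) = val σ (2*i+1) by omega]; exact f3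

theorem F_full {K D p A R} (h : St K D p A R) (hD : ∀ t, t < 17 → t ∈ D) :
    (F K D p).card = if p 0 < p 16 then 1 else 0 := by
  split
  · rename_i hlt
    have hinj : Function.Injective (fun t : Fin 17 => (⟨p t, h.lt t (hD t t.isLt)⟩ : Fin 17)) := by
      intro t u htu
      have := h.inj t (hD t t.isLt) u (hD u u.isLt) (by simpa using htu)
      exact Fin.ext this
    let τ : Equiv.Perm (Fin 17) := Equiv.ofBijective _ (Finite.injective_iff_bijective.1 hinj)
    have hτ : ∀ t < 17, val τ t = p t := by
      intro t ht
      simp [val, ht, τ]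
    rw [Finset.card_eq_one]
    refine ⟨τ, ?_⟩
    ext σ
    rw [mem_F, Finset.mem_singleton]
    constructor
    · rintro ⟨_, h2⟩
      ext t
      have h3 := h2 t (hD t t.isLt)
      rw [← hτ t t.isLt] at h3
      simpa [val] using h3
    · rintro rfl
      refine ⟨⟨fun i hi => ?_, ?_⟩, fun t ht => hτ t (h.dom t ht)⟩
      · rw [hτ _ (by omega), hτ _ (by omega), hτ _ (by omega)]
        exact (h.edge i (hD _ (by omega))).2.2
      · rw [hτ _ (by omega), hτ _ (by omega)]; exact hlt
  · rename_i hlt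
    rw [Finset.card_eq_zero, Finset.eq_empty_iff_forall_notMem]
    intro σ hσ
    have h1 := (mem_F.1 hσ).1.2
    rw [(mem_F.1 hσ).2 0 (hD _ (by omega)), (mem_F.1 hσ).2 16 (hD _ (by omega))] at h1
    exact hlt h1

theorem bit_all {x : ℕ} (hx : x < 17) : Nat.testBit 131071 x = true := by
  have := Nat.testBit_two_pow_sub_one 17 x
  simpa [hx] using this

theorem fin1_eq {K D p A R} (h : St K D p A R) (hK : K ≤ 31)
    (hD : ∀ t, t ∈ D ↔ 2 ≤ t ∧ t ≤ 14) :
    fin1 K (p 2) (p 14) A R = (F K D p).card := by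
  unfold fin1
  refine step_eq h hK (i := 0) (a := 2) (c := 0) (by omega) (Or.inr ⟨rfl, rfl⟩)
    (by simp [hD]) (by simp [hD]) (by simp [hD]) (fun σ _ => bit_all (val_lt _ _)) _ ?_
  intro v0 e0 A' R' _ h'
  have e14 : upd p (2*0+1) 0 e0 v0 14 = p 14 := by simp [upd]
  have e00 : upd p (2*0+1) 0 e0 v0 0 = v0 := by simp [upd]
  rw [← e14]
  refine step_eq h' hK (i := 7) (a := 14) (c := 16) (by omega) (Or.inl ⟨rfl, rfl⟩)
    (by simp [hD]) (by simp [hD]) (by simp [hD]) (fun σ _ => bit_all (val_lt _ _)) _ ?_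
  intro v8 e8 A'' R'' _ h''
  rw [F_full h'' (by intro t ht; simp only [Finset.mem_insert, hD]; omega)]
  have e1 : upd (upd p (2*0+1) 0 e0 v0) (2*7+1) 16 e8 v8 16 = v8 := by simp [upd]
  have e2 : upd (upd p (2*0+1) 0 e0 v0) (2*7+1) 16 e8 v8 0 = v0 := by simp [upd]
  rw [e1, e2]
  by_cases hlt : v0 < v8
  · have : Nat.ble v8 v0 = false := by
      rw [Bool.eq_false_iff]; intro h; have := Nat.le_of_ble_eq_true h; omega
    rw [this, if_pos hlt]
  · have : Nat.ble v8 v0 = true := Nat.ble_eq_true_of_le (by omega)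
    rw [this, if_neg hlt]

/-- Sum of the labels of the inner vertices after vertex `i`. -/
def isum (σ : Equiv.Perm (Fin 17)) : ℕ → ℕ
  | 0 => 0
  | n + 1 => val σ (2 * (7 - n)) + isum σ n

theorem pmask_ok {K D p A R n s} (h : St K D p A R) (hn : n + 1 ≤ 6)
    (hD : ∀ t, t ∈ D ↔ 2 ≤ t ∧ t ≤ 2 * (7 - (n + 1)))
    (hs : ∀ σ ∈ F K D p, isum σ (n + 1) = s) (σ) (hσ : σ ∈ F K D p) :
    (pmask K n A R s).testBit (val σ (2 * (7 - n))) = true := by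
  have hs' := hs σ hσ
  have hv := (mem_F.1 hσ).1.1
  match n, hn, hD, hs' with
  | 0, _, hD, hs' =>
    have h1 : pmask K 0 A R s = 2 ^ s := rfl
    simp only [isum] at hs'
    rw [h1, Nat.testBit_two_pow]
    simp at hs' ⊢
    omega
  | 1, _, hD, hs' =>
    have h1 : pmask K 1 A R s = R >>> (32 - s) := rfl
    simp only [isum] at hs'
    have l1 := val_lt σ 12
    have l2 := val_lt σ 14
    norm_num at hs'
    rw [h1, Nat.testBit_shiftRight, h.hR]
    norm_num
    refine ⟨by omega, ?_⟩
    rw [show 32 - (32 - s + val σ 12) = val σ 14 by omega]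
    exact h.free hσ (by omega) (by rw [hD]; omega)
  | 2, _, hD, hs' =>
    have h1 : pmask K 2 A R s = (A >>> (K - s)) <<< (s - K) := rfl
    simp only [isum] at hs'
    norm_num at hs'
    have h6 := hv 6 (by omega)
    norm_num at h6
    rw [h1, Nat.testBit_shiftLeft, Nat.testBit_shiftRight]
    norm_num
    refine ⟨by omega, ?_⟩
    rw [show K - s + (val σ 10 - (s - K)) = val σ 13 by omega]
    exact h.free hσ (by omega) (by rw [hD]; omega)
  | n + 3, _, hD, hs' =>
    exact bit_all (val_lt _ _)

theorem dfs_eq {K : ℕ} (hK : K ≤ 31) (v1 n : ℕ) : n ≤ 6 → ∀ D p A R s, St K D p A R →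
    (∀ t, t ∈ D ↔ 2 ≤ t ∧ t ≤ 2 * (7 - n)) → (∀ σ ∈ F K D p, isum σ n = s) → p 2 = v1 →
    dfs K v1 n s (p (2 * (7 - n))) A R = (F K D p).card := by
  induction n with
  | zero =>
    intro _ D p A R s h hD hs hv1
    subst hv1
    exact fin1_eq h hK hD
  | succ n ih =>
    intro hn D p A R s h hD hs hv1
    have h1 : dfs K v1 (n+1) s (p (2 * (7 - (n+1)))) A R =
      step K (p (2 * (7 - (n+1)))) A R (pmask K n A R s) fun v A' R' =>
       Bool.rec (motive := fun _ => ℕ) 0 (force (s - v) fun s' => dfs K v1 n s' v A' R')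
        (Nat.ble v s) := rfl
    rw [h1]
    refine step_eq h hK (i := 7 - (n+1)) (c := 2 * (7 - n)) (by omega) (Or.inl ⟨rfl, by omega⟩)
      (by rw [hD]; omega) (by rw [hD]; omega) (by rw [hD]; omega)
      (pmask_ok h hn hD hs) _ ?_
    intro v e A' R' _ h'
    set p' := upd p (2 * (7 - (n+1)) + 1) (2 * (7 - n)) e v with hp'
    set D' := insert (2 * (7 - (n+1)) + 1) (insert (2 * (7 - n)) D) with hD'
    have hpv : p' (2 * (7 - n)) = v := by simp [hp', upd]
    have hsum : ∀ σ ∈ F K D' p', v + isum σ n = s := by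
      intro σ hσ
      obtain ⟨g1, g2⟩ := mem_F.1 hσ
      have hσ' : σ ∈ F K D p := by
        rw [mem_F]
        refine ⟨g1, fun t ht => ?_⟩
        rw [g2 t (by simp [hD', ht])]
        have ht' := (hD t).1 ht
        have h1 : t ≠ 2 * (7 - n) := by omega
        have h2 : t ≠ 2 * (7 - (n+1)) + 1 := by omega
        simp only [hp', upd, h1, h2, if_false]
      have := hs σ hσ'
      rw [isum, g2 _ (by simp [hD']), hpv] at this
      exact this
    by_cases hvs : v ≤ s
    · have : Nat.ble v s = true := Nat.ble_eq_true_of_le hvs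
      rw [this]
      simp only [force_eq]
      have := ih (by omega) D' p' A' R' (s - v) h'
        (by intro t; simp only [hD', Finset.mem_insert, hD]; omega)
        (fun σ hσ => by have := hsum σ hσ; omega)
        (by
          rw [← hv1]
          have h1 : 2 ≠ 2 * (7 - n) := by omega
          have h2 : 2 ≠ 2 * (7 - (n+1)) + 1 := by omega
          simp only [hp', upd, h1, h2, if_false])
      rw [hpv] at this
      exact this
    · have : Nat.ble v s = false := by
        rw [Bool.eq_false_iff]; intro h; exact hvs (Nat.le_of_ble_eq_true h)
      rw [this]
      symm
      rw [Finset.card_eq_zero, Finset.eq_empty_iff_forall_notMem]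
      intro σ hσ
      have := hsum σ hσ
      omega

theorem val_sum (σ : Equiv.Perm (Fin 17)) : ∑ t ∈ Finset.range 17, val σ t = 136 := by
  rw [Finset.sum_range]
  have h1 : ∀ t : Fin 17, val σ t = (σ t).val := fun t => by simp [val]
  simp only [h1]
  rw [Equiv.sum_comp σ (fun x : Fin 17 => x.val)]
  rfl

theorem valid_sum {K σ} (h : Valid K σ) : isum σ 7 + 136 = 8 * K := by
  have hs := val_sum σ
  have h0 := h.1 0 (by omega)
  have h1 := h.1 1 (by omega)
  have h2 := h.1 2 (by omega)
  have h3 := h.1 3 (by omega)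
  have h4 := h.1 4 (by omega)
  have h5 := h.1 5 (by omega)
  have h6 := h.1 6 (by omega)
  have h7 := h.1 7 (by omega)
  simp only [Finset.sum_range_succ, Finset.sum_range_zero] at hs
  simp only [isum]
  norm_num at *
  omega

theorem valid_range {K σ} (h : Valid K σ) : 17 ≤ K ∧ K < 32 := by
  have h1 := valid_sum h
  have h2 : isum σ 7 ≤ 112 := by
    simp only [isum]
    have := val_lt σ
    have a1 := this (2 * (7 - 0))
    have a2 := this (2 * (7 - 1))
    have a3 := this (2 * (7 - 2))
    have a4 := this (2 * (7 - 3))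
    have a5 := this (2 * (7 - 4))
    have a6 := this (2 * (7 - 5))
    have a7 := this (2 * (7 - 6))
    omega
  omega

theorem total_eq {K I : ℕ} (hK : K ≤ 31) (hI : I + 136 = 8 * K) :
    total K I = (F K ∅ (fun _ => 0)).card := by
  unfold total
  rw [loop_eq _ 17 131071 17 (by norm_num) le_rfl]
  rw [Finset.card_eq_sum_card_fiberwise (f := fun σ => val σ 2) (t := Finset.range 17)
      (fun σ _ => by simpa using val_lt σ 2)]
  apply Finset.sum_congr rfl
  intro v hv
  have hv : v < 17 := by simpa using hv
  rw [if_pos (bit_all hv)]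
  have hF : (F K ∅ (fun _ => 0)).filter (fun σ => val σ 2 = v) = F K {2} (fun _ => v) := by
    ext σ
    simp [mem_F]
  rw [hF]
  have hsum : ∀ σ ∈ F K {2} (fun _ => v), v + isum σ 6 = I := by
    intro σ hσ
    obtain ⟨g1, g2⟩ := mem_F.1 hσ
    have h1 := valid_sum g1
    have h2 := g2 2 (by simp)
    rw [isum] at h1
    norm_num at h1
    omega
  have htop : top K I v = Bool.rec (motive := fun _ => ℕ) 0
     (force (I - v) fun s => force (131071 ^^^ 2^v) fun A =>
      force (8589869056 ^^^ 2^(32-v)) fun R => dfs K v 6 s v A R)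
     (Nat.ble v I) := rfl
  rw [htop]
  by_cases hvs : v ≤ I
  · have : Nat.ble v I = true := Nat.ble_eq_true_of_le hvs
    rw [this]
    simp only [force_eq]
    refine dfs_eq hK v 6 le_rfl {2} (fun _ => v) _ _ (I - v) ?_ ?_ ?_ rfl
    · refine ⟨by simp, ?_, by simp [hv], by simp, ?_, ?_⟩
      · intro i hi
        simp at hi
      · intro x
        rw [Nat.testBit_xor, Nat.testBit_two_pow, show (131071:ℕ) = 2^17-1 by norm_num,
          Nat.testBit_two_pow_sub_one]
        simp
        by_cases h : v = x
        · subst h; simp [hv]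
        · simp [h]
      · intro x
        rw [Nat.testBit_xor, Nat.testBit_xor, Nat.testBit_two_pow, Nat.testBit_two_pow,
          show (8589869056:ℕ) = (2^17-1) <<< 16 by decide, show (131071:ℕ) = 2^17-1 by norm_num,
          Nat.testBit_shiftLeft,
          Nat.testBit_two_pow_sub_one, Nat.testBit_two_pow_sub_one]
        by_cases hx : x ≤ 32
        · have e1 : decide (32 - v = x) = decide (v = 32 - x) := by
            rw [decide_eq_decide]; omega
          have e2 : (decide (x ≥ 16) && decide (x - 16 < 17)) = decide (32 - x < 17) := by
            rw [← Bool.decide_and, decide_eq_decide]; omega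
          rw [e1, e2]; simp [hx]
        · have e1 : decide (32 - v = x) = false := by
            rw [decide_eq_false_iff_not]; omega
          have e2 : decide (x - 16 < 17) = false := by
            rw [decide_eq_false_iff_not]; omega
          rw [e1, e2]; simp [hx]
    · intro t; simp only [Finset.mem_singleton]; omega
    · intro σ hσ
      have := hsum σ hσ
      omega
  · have : Nat.ble v I = false := by
      rw [Bool.eq_false_iff]; intro h; exact hvs (Nat.le_of_ble_eq_true h)
    rw [this]
    symm
    rw [Finset.card_eq_zero, Finset.eq_empty_iff_forall_notMem]
    intro σ hσ
    have := hsum σ hσ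
    omega

theorem count_eq : pathEMTLCountUpToRev 8 = ∑ K ∈ Finset.Ico 17 32, total K (8 * K - 136) := by
  have h1 : ∀ K ∈ Finset.Ico 17 32, total K (8 * K - 136) = (F K ∅ (fun _ => 0)).card := by
    intro K hK
    rw [Finset.mem_Ico] at hK
    exact total_eq (by omega) (by omega)
  rw [Finset.sum_congr rfl h1, ← Finset.card_biUnion]
  · unfold pathEMTLCountUpToRev
    refine congrArg Finset.card ?_
    ext σ
    change Equiv.Perm (Fin 17) at σ
    have hval : ∀ (t : ℕ) (ht : t < 17), (σ ⟨t, ht⟩).val = val σ t := by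
      intro t ht; simp [val, ht]
    refine Iff.trans (@Finset.mem_filter _ _ (_) _ _) (Iff.trans ?_ Finset.mem_biUnion.symm)
    constructor
    · rintro ⟨_, ⟨k, hk⟩, hlt⟩
      have hV : Valid (k - 3) σ := by
        refine ⟨fun i hi => ?_, ?_⟩
        · have h2 : ((σ ⟨2 * i, by omega⟩).val + 1) + ((σ ⟨2 * i + 1, by omega⟩).val + 1) +
              ((σ ⟨2 * i + 2, by omega⟩).val + 1) = k := hk ⟨i, hi⟩
          rw [hval, hval, hval] at h2
          omega
        · rw [← hval _ (by omega), ← hval _ (by omega)]; exact hlt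
      exact ⟨k - 3, Finset.mem_Ico.2 (valid_range hV), mem_F.2 ⟨hV, by simp⟩⟩
    · rintro ⟨K, _, hF⟩
      have hV := (mem_F.1 hF).1
      refine ⟨Finset.mem_univ _, ⟨K + 3, fun i => ?_⟩, ?_⟩
      · have h1 := hV.1 i.1 i.2
        have h2 : ((σ ⟨2 * i.1, by omega⟩).val + 1) + ((σ ⟨2 * i.1 + 1, by omega⟩).val + 1) +
              ((σ ⟨2 * i.1 + 2, by omega⟩).val + 1) = K + 3 := by
          rw [hval, hval, hval]
          omega
        exact h2
      · have := hV.2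
        rw [← hval _ (by omega), ← hval _ (by omega)] at this
        exact this
  · intro K _ L _ hKL
    rw [Function.onFun, Finset.disjoint_left]
    intro σ h1 h2
    have := (mem_F.1 h1).1.1 0 (by omega)
    have := (mem_F.1 h2).1.1 0 (by omega)
    omega

noncomputable def chk (K I c : ℕ) : Bool := Nat.beq (total K I) c

theorem chk_eq {K I c : ℕ} (h : chk K I c = true) : total K I = c :=
  Nat.eq_of_beq_eq_true h

theorem t17 : chk 17 0 0 = true := by decide +kernel
theorem t18 : chk 18 8 0 = true := by decide +kernel
theorem t19 : chk 19 16 0 = true := by decide +kernel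
theorem t20 : chk 20 24 224 = true := by decide +kernel
theorem t21 : chk 21 32 1604 = true := by decide +kernel
theorem t22 : chk 22 40 2332 = true := by decide +kernel
theorem t23 : chk 23 48 5172 = true := by decide +kernel
theorem t24 : chk 24 56 4744 = true := by decide +kernel
theorem t25 : chk 25 64 5172 = true := by decide +kernel
theorem t26 : chk 26 72 2332 = true := by decide +kernel
theorem t27 : chk 27 80 1604 = true := by decide +kernel
theorem t28 : chk 28 88 224 = true := by decide +kernel
theorem t29 : chk 29 96 0 = true := by decide +kernel
theorem t30 : chk 30 104 0 = true := by decide +kernel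
theorem t31 : chk 31 112 0 = true := by decide +kernel

/-- Numbers of labelings for the individual magic constants. -/
def table (K : ℕ) : ℕ := [224, 1604, 2332, 5172, 4744, 5172, 2332, 1604, 224].getD (K - 20) 0 *
  (if K < 20 then 0 else 1)

theorem total_table (g : ℕ → ℕ → ℕ) (h17 : g 17 0 = 0) (h18 : g 18 8 = 0) (h19 : g 19 16 = 0)
    (h20 : g 20 24 = 224) (h21 : g 21 32 = 1604) (h22 : g 22 40 = 2332) (h23 : g 23 48 = 5172)
    (h24 : g 24 56 = 4744) (h25 : g 25 64 = 5172) (h26 : g 26 72 = 2332) (h27 : g 27 80 = 1604)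
    (h28 : g 28 88 = 224) (h29 : g 29 96 = 0) (h30 : g 30 104 = 0) (h31 : g 31 112 = 0) :
    ∑ K ∈ Finset.Ico 17 32, g K (8 * K - 136) = 23408 := by
  have h : ∀ K ∈ Finset.Ico 17 32, g K (8 * K - 136) = table K := by
    intro K hK
    rw [Finset.mem_Ico] at hK
    obtain ⟨h1, h2⟩ := hK
    interval_cases K <;> assumption
  rw [Finset.sum_congr rfl h]
  decide +kernel

end EM

/-- The number of edge-magic total labelings of the path `P 8`, counted up to the
reversal symmetry of the path, is `23408`. -/
theorem pathEMTLCountUpToRev_P8 : pathEMTLCountUpToRev 8 = 23408 :=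
  EM.count_eq.trans (EM.total_table EM.total
    (EM.chk_eq EM.t17) (EM.chk_eq EM.t18) (EM.chk_eq EM.t19)
    (EM.chk_eq EM.t20) (EM.chk_eq EM.t21) (EM.chk_eq EM.t22)
    (EM.chk_eq EM.t23) (EM.chk_eq EM.t24) (EM.chk_eq EM.t25)
    (EM.chk_eq EM.t26) (EM.chk_eq EM.t27) (EM.chk_eq EM.t28)
    (EM.chk_eq EM.t29) (EM.chk_eq EM.t30) (EM.chk_eq EM.t31))
end

section
/- The number of edge-magic total labelings of the path P_9 (the path with 10 vertices and 9 edges), counted up to the reversal symmetry of the path, is 133808. -/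
namespace P9

/-! ### Kernel-friendly computation (call by value on big natural numbers) -/

/-- Evaluate `x` to a literal before passing it on. -/
def force {α : Type} (x : ℕ) (f : ℕ → α) : α :=
  Nat.rec (motive := fun _ => α) (f 0) (fun n _ => f n) (Nat.add x 1)

/-- Evaluate all entries of a list before passing it on. -/
def forceL {α : Type} (l : List ℕ) : (List ℕ → α) → α :=
  List.rec (motive := fun _ => (List ℕ → α) → α) (fun k => k [])
    (fun x _ ih k => force x fun y => ih fun ys => k (y :: ys)) l

/-- `0` encodes a forbidden label, `n+1` a label acting as a left shift by `n`. -/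
def sh (u f : ℕ) : ℕ := Nat.rec (motive := fun _ => ℕ) 0 (fun n _ => Nat.shiftLeft f n) u

def acc (u f s : ℕ) : ℕ :=
  Nat.rec (motive := fun _ => ℕ) s (fun n _ => Nat.add (Nat.shiftLeft f n) s) u

def dot (F : List ℕ) : List ℕ → ℕ :=
  List.rec (motive := fun _ => List ℕ → ℕ) (fun _ => 0)
    (fun f _ ih R => List.rec (motive := fun _ => ℕ) 0 (fun r R' _ => acc r f (ih R')) R) F

def stepL (M : ℕ) (F U : List ℕ) : List ℕ → List ℕ :=
  List.rec (motive := fun _ => List ℕ → List ℕ) (fun _ => [])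
    (fun u _ ih R => Nat.land (sh u (dot F R)) M :: ih R.tail) U

def total (F : List ℕ) : ℕ :=
  List.rec (motive := fun _ => ℕ) 0 (fun f _ s => Nat.add f s) F

def iter (M : ℕ) (U R : List ℕ) (n : ℕ) : List ℕ → ℕ :=
  Nat.rec (motive := fun _ => List ℕ → ℕ) total
    (fun _ ih F => forceL (stepL M F U R) ih) n

def start (U : List ℕ) : List ℕ :=
  List.rec (motive := fun _ => List ℕ) [] (fun u _ ih => sh u 1 :: ih) U

/-- `43 * 2 ^ i + 1` for `i < 15`. -/
def slots : List ℕ :=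
  [44, 87, 173, 345, 689, 1377, 2753, 5505, 11009, 22017, 44033, 88065, 176129, 352257, 704513]

/-- The mask `(2 ^ 43) ^ (2 ^ 15) - 1`. -/
def mask : ℕ := Nat.sub (Nat.shiftLeft 1 1409024) 1

/-- The number of walks with magic sum `z + 18` and prescribed total weight; `pre` says which
of the small (weight zero) labels are allowed. -/
def run (z : ℕ) (pre : List ℕ) : ℕ :=
  force mask fun M =>
  forceL (pre ++ slots) fun U =>
  forceL (List.replicate z 0 ++ U.reverse) fun R =>
  forceL (start U) fun F =>
  Nat.shiftRight (Nat.land (iter M U R 9 F) M) 1408981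

/-- Inclusion-exclusion over the weight zero labels below `n`. -/
def IE (z n : ℕ) : List ℕ → ℕ :=
  Nat.rec (motive := fun _ => List ℕ → ℕ) (run z)
    (fun _ ih pre => Nat.sub (ih (1 :: pre)) (ih (0 :: pre))) n

/-! ### Unfolding the computation -/

theorem force_eq {α : Type} (x : ℕ) (f : ℕ → α) : force x f = f x := rfl

theorem forceL_eq {α : Type} (l : List ℕ) (k : List ℕ → α) : forceL l k = k l := by
  induction l generalizing k with
  | nil => rfl
  | cons x xs ih => exact ih (fun ys => k (x :: ys))

theorem sh_zero (f : ℕ) : sh 0 f = 0 := rfl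
theorem sh_succ (n f : ℕ) : sh (n + 1) f = f <<< n := rfl

theorem acc_eq (u f s : ℕ) : acc u f s = sh u f + s := by
  cases u with
  | zero => simp [acc, sh]
  | succ n => rfl

theorem dot_eq (F R : List ℕ) :
    dot F R = ((List.range F.length).map fun v => sh (R.getD v 0) (F.getD v 0)).sum := by
  induction F generalizing R with
  | nil => rfl
  | cons f fs ih =>
    cases R with
    | nil =>
      have : dot (f :: fs) [] = 0 := rfl
      rw [this]
      simp [sh_zero]
    | cons r rs =>
      have : dot (f :: fs) (r :: rs) = acc r f (dot fs rs) := rfl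
      rw [this, acc_eq, ih, List.length_cons, List.range_succ_eq_map]
      simp [Function.comp_def]

theorem stepL_length (M : ℕ) (F U R : List ℕ) : (stepL M F U R).length = U.length := by
  induction U generalizing R with
  | nil => rfl
  | cons u us ih =>
    have : stepL M F (u :: us) R = Nat.land (sh u (dot F R)) M :: stepL M F us R.tail := rfl
    rw [this, List.length_cons, ih, List.length_cons]

theorem stepL_getD (M : ℕ) (F U R : List ℕ) (w : ℕ) :
    (stepL M F U R).getD w 0 = sh (U.getD w 0) (dot F (R.drop w)) &&& M := by
  induction U generalizing R w with
  | nil => simp [stepL, sh_zero]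
  | cons u us ih =>
    have : stepL M F (u :: us) R = (sh u (dot F R) &&& M) :: stepL M F us R.tail := rfl
    rw [this]
    cases w with
    | zero => simp
    | succ w =>
      rw [List.getD_cons_succ, ih, List.getD_cons_succ]
      simp

theorem total_eq (F : List ℕ) :
    total F = ((List.range F.length).map fun v => F.getD v 0).sum := by
  induction F with
  | nil => rfl
  | cons f fs ih =>
    have : total (f :: fs) = f + total fs := rfl
    rw [this, ih, List.length_cons, List.range_succ_eq_map]
    simp [Function.comp_def]

theorem start_length (U : List ℕ) : (start U).length = U.length := by
  induction U with
  | nil => rfl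
  | cons u us ih =>
    have : start (u :: us) = sh u 1 :: start us := rfl
    rw [this, List.length_cons, ih, List.length_cons]

theorem start_getD (U : List ℕ) (w : ℕ) :
    (start U).getD w 0 = sh (U.getD w 0) 1 := by
  induction U generalizing w with
  | nil => simp [start, sh_zero]
  | cons u us ih =>
    have : start (u :: us) = sh u 1 :: start us := rfl
    rw [this]
    cases w with
    | zero => simp
    | succ w => rw [List.getD_cons_succ, ih, List.getD_cons_succ]

theorem iter_eq (M : ℕ) (U R : List ℕ) (n : ℕ) (F : List ℕ) :
    iter M U R n F = total ((fun F => stepL M F U R)^[n] F) := by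
  induction n generalizing F with
  | zero => rfl
  | succ n ih =>
    have : iter M U R (n + 1) F = forceL (stepL M F U R) (iter M U R n) := rfl
    rw [this, forceL_eq, ih, Function.iterate_succ_apply]

theorem run_eq (z : ℕ) (pre : List ℕ) :
    run z pre = (total ((fun F => stepL mask F (pre ++ slots)
      (List.replicate z 0 ++ (pre ++ slots).reverse))^[9]
        (start (pre ++ slots))) &&& mask) >>> 1408981 := by
  unfold run
  rw [force_eq, forceL_eq, forceL_eq, forceL_eq, iter_eq]
  rfl

theorem R_getD (z : ℕ) (U : List ℕ) (hU : U.length = 19) (i : ℕ) :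
    (List.replicate z 0 ++ U.reverse).getD i 0 =
      if i ≤ z + 18 then U.getD (z + 18 - i) 0 else 0 := by
  by_cases h : i < z
  · rw [List.getD_append _ _ _ _ (by simpa using h), if_pos (by omega)]
    rw [List.getD_eq_default (n := z + 18 - i) _ _ (by omega)]
    simp [List.getD_eq_getElem?_getD, h]
  · rw [List.getD_append_right _ _ _ _ (by simpa using h)]
    split_ifs with h2
    · rw [List.length_replicate, List.getD_eq_getElem?_getD, List.getD_eq_getElem?_getD,
        List.getElem?_reverse (by omega)]
      congr 2
      omega
    · rw [List.getD_eq_default]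
      simp
      omega

/-! ### Walks -/

/-- The weight of a label. -/
def wt (a : ℕ) : ℕ := if a < 4 then 0 else 2 ^ (a - 4)

def wsum (l : List ℕ) : ℕ := (l.map wt).sum

/-- All label sequences with `j` edges, starting at vertex label `w`. -/
def Wk (u : ℕ → ℕ) (K : ℕ) : ℕ → ℕ → List (List ℕ)
  | 0, w => if u w = 0 then [] else [[w]]
  | j + 1, w => if u w = 0 then [] else
      (List.range 19).flatMap fun v =>
        if w + v ≤ K ∧ u (K - w - v) ≠ 0 then
          (Wk u K j v).map fun l => w :: (K - w - v) :: l
        else []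

theorem sum_le_of (f : ℕ → ℕ) (n c : ℕ) (h : ∀ v < n, f v ≤ c) :
    ((List.range n).map f).sum ≤ n * c := by
  have := List.sum_le_card_nsmul ((List.range n).map f) c (by
    intro x hx
    obtain ⟨v, hv, rfl⟩ := List.mem_map.1 hx
    exact h v (List.mem_range.1 hv))
  simpa using this

theorem Wk_length (u : ℕ → ℕ) (K j w : ℕ) : (Wk u K j w).length ≤ 19 ^ j := by
  induction j generalizing w with
  | zero => unfold Wk; split_ifs <;> simp
  | succ j ih =>
    unfold Wk
    split_ifs
    · simp
    · rw [List.length_flatMap, pow_succ, mul_comm]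
      apply sum_le_of
      intro v _
      split_ifs
      · simpa using ih v
      · simp

/-- The contribution of a walk of weight `x`. -/
def ex (x : ℕ) : ℕ := (2 ^ 43) ^ x

theorem shl_one (n : ℕ) : Nat.shiftLeft 1 n = 2 ^ n := by
  have := Nat.shiftLeft_eq 1 n
  rw [one_mul] at this
  exact this

theorem mask_gen (n : ℕ) : Nat.sub (Nat.shiftLeft 1 n) 1 = 2 ^ n - 1 := by
  rw [shl_one]
  rfl

theorem and_mask (x : ℕ) : x &&& mask = x % (2 ^ 43) ^ 32768 := by
  have h : (2 ^ 43) ^ 32768 = 2 ^ (43 * 32768) := (pow_mul 2 43 32768).symm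
  have h2 : mask = 2 ^ (43 * 32768) - 1 := by
    have e : 43 * 32768 = 1409024 := by norm_num
    unfold mask
    rw [e, mask_gen]
  rw [h, h2, Nat.and_two_pow_sub_one_eq_mod]

theorem sum_flatMap' {β : Type} (L : List β) (f : β → List ℕ) :
    (L.flatMap f).sum = (L.map fun v => (f v).sum).sum := by
  induction L with
  | nil => rfl
  | cons x xs ih => rw [List.flatMap_cons, List.sum_append, ih, List.map_cons, List.sum_cons]

theorem sh_modEq {Q f g : ℕ} (u : ℕ) (h : f ≡ g [MOD Q]) : sh u f ≡ sh u g [MOD Q] := by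
  cases u with
  | zero => rfl
  | succ n =>
    rw [sh_succ, sh_succ, Nat.shiftLeft_eq, Nat.shiftLeft_eq]
    exact h.mul_right _

theorem sum_modEq {Q : ℕ} (L : List ℕ) (f g : ℕ → ℕ) (h : ∀ v, f v ≡ g v [MOD Q]) :
    (L.map f).sum ≡ (L.map g).sum [MOD Q] := by
  induction L with
  | nil => rfl
  | cons x xs ih =>
    rw [List.map_cons, List.map_cons, List.sum_cons, List.sum_cons]
    exact (h x).add ih

theorem shift_sum (L : List ℕ) (n : ℕ) :
    (L.map ex).sum <<< (43 * n) = (L.map fun x => ex (x + n)).sum := by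
  rw [Nat.shiftLeft_eq, pow_mul]
  induction L with
  | nil => simp
  | cons x xs ih =>
    rw [List.map_cons, List.map_cons, List.sum_cons, List.sum_cons, add_mul, ih]
    congr 1
    unfold ex
    rw [pow_add]

theorem top_sum (B m : ℕ) (L : List ℕ) (hL : L.length < B) :
    (L.map fun x => B ^ x).sum % B ^ (m + 2) / B ^ (m + 1) = L.count (m + 1) := by
  have hB : 0 < B := by omega
  have key : ∀ L : List ℕ, ∃ q r, (L.map fun x => B ^ x).sum =
      (L.count (m + 1) * B ^ (m + 1) + r) + B ^ (m + 2) * q ∧ r ≤ L.length * B ^ m := by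
    intro L
    induction L with
    | nil => exact ⟨0, 0, by simp⟩
    | cons x xs ih =>
      obtain ⟨q, r, h1, h2⟩ := ih
      have hle : r ≤ (xs.length + 1) * B ^ m := by
        rw [add_mul]
        exact h2.trans (Nat.le_add_right _ _)
      rw [List.map_cons, List.sum_cons, List.length_cons, h1]
      rcases lt_trichotomy x (m + 1) with hx | hx | hx
      · refine ⟨q, B ^ x + r, ?_, ?_⟩
        · rw [List.count_cons_of_ne (by omega)]
          ring
        · have : B ^ x ≤ B ^ m := Nat.pow_le_pow_right hB (by omega)
          rw [add_mul, one_mul]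
          omega
      · refine ⟨q, r, ?_, hle⟩
        rw [hx, List.count_cons_self]
        ring
      · obtain ⟨y, rfl⟩ : ∃ y, x = m + 2 + y := ⟨x - (m + 2), by omega⟩
        refine ⟨B ^ y + q, r, ?_, hle⟩
        rw [List.count_cons_of_ne (by omega)]
        ring
  obtain ⟨q, r, h1, h2⟩ := key L
  have h3 : r < B ^ (m + 1) := by
    rw [pow_succ, mul_comm]
    exact h2.trans_lt (Nat.mul_lt_mul_of_pos_right hL (Nat.pow_pos hB))
  have h4 : L.count (m + 1) < B := (List.count_le_length).trans_lt hL
  have h5 : L.count (m + 1) * B ^ (m + 1) + r < B ^ (m + 2) := by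
    have h6 : (L.count (m + 1) + 1) * B ^ (m + 1) ≤ B * B ^ (m + 1) :=
      Nat.mul_le_mul_right _ h4
    have h7 : B ^ (m + 2) = B * B ^ (m + 1) := by ring
    rw [add_mul, one_mul] at h6
    omega
  rw [h1, Nat.add_mul_mod_self_left, Nat.mod_eq_of_lt h5, add_comm,
    Nat.add_mul_div_right _ _ (Nat.pow_pos hB), Nat.div_eq_of_lt h3, zero_add]

/-- The states of the computation are the generating functions of the walks. -/
theorem state_eq (Q M : ℕ) (hM : ∀ x, x &&& M = x % Q) (z : ℕ) (U : List ℕ) (hU : U.length = 19)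
    (hu : ∀ a, U.getD a 0 = 0 ∨ U.getD a 0 = 43 * wt a + 1) (j : ℕ) :
    ((fun F => stepL M F U (List.replicate z 0 ++ U.reverse))^[j] (start U)).length = 19 ∧
    ∀ w, ((fun F => stepL M F U (List.replicate z 0 ++ U.reverse))^[j] (start U)).getD w 0 ≡
      ((Wk (fun a => U.getD a 0) (z + 18) j w).map fun l => ex (wsum l)).sum [MOD Q] := by
  induction j with
  | zero =>
    refine ⟨by simpa [start_length] using hU, fun w => ?_⟩
    rw [Function.iterate_zero_apply, start_getD]
    unfold Wk
    rcases hu w with h | h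
    · rw [h, sh_zero, if_pos rfl]
      rfl
    · have h1 := shift_sum [0] (wt w)
      have h2 : ex 0 = 1 := rfl
      simp only [List.map_cons, List.map_nil, List.sum_cons, List.sum_nil, add_zero, zero_add,
        h2] at h1
      rw [h, sh_succ, h1, if_neg (by omega)]
      simp [wsum, Nat.ModEq]
  | succ j ih =>
    obtain ⟨ih1, ih2⟩ := ih
    rw [Function.iterate_succ_apply']
    refine ⟨by rw [stepL_length, hU], fun w => ?_⟩
    rw [stepL_getD, hM, dot_eq, ih1]
    refine (Nat.mod_modEq _ _).trans ?_
    refine (sh_modEq _ (sum_modEq _ _ _ fun v => sh_modEq _ (ih2 v))).trans ?_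
    have hterm : ∀ v, sh (((List.replicate z 0 ++ U.reverse).drop w).getD v 0)
        ((Wk (fun a => U.getD a 0) (z + 18) j v).map fun l => ex (wsum l)).sum =
        ((if w + v ≤ z + 18 ∧ U.getD (z + 18 - w - v) 0 ≠ 0 then
          (Wk (fun a => U.getD a 0) (z + 18) j v).map
            fun l => wsum l + wt (z + 18 - w - v) else []).map ex).sum := by
      intro v
      have h0 : ((List.replicate z 0 ++ U.reverse).drop w).getD v 0 =
          (List.replicate z 0 ++ U.reverse).getD (w + v) 0 := by
        simp only [List.getD_eq_getElem?_getD, List.getElem?_drop]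
      rw [h0, R_getD z U hU, ← Nat.sub_sub]
      by_cases hwv : w + v ≤ z + 18
      · rw [if_pos hwv]
        rcases hu (z + 18 - w - v) with h | h
        · rw [h, if_neg (by simp)]
          simp [sh_zero]
        · rw [h, if_pos ⟨hwv, by omega⟩, sh_succ]
          have := shift_sum ((Wk (fun a => U.getD a 0) (z + 18) j v).map wsum)
            (wt (z + 18 - w - v))
          simpa [Function.comp_def] using this
      · rw [if_neg hwv, if_neg (fun h => hwv h.1)]
        simp [sh_zero]
    simp only [hterm]
    rcases hu w with h | h
    · rw [h, sh_zero]
      unfold Wk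
      rw [if_pos (by exact h)]
      rfl
    · have h1 := shift_sum ((List.range 19).flatMap fun v =>
          if w + v ≤ z + 18 ∧ U.getD (z + 18 - w - v) 0 ≠ 0 then
          (Wk (fun a => U.getD a 0) (z + 18) j v).map
            fun l => wsum l + wt (z + 18 - w - v) else []) (wt w)
      rw [h, sh_succ]
      rw [List.map_flatMap, List.map_flatMap, sum_flatMap', sum_flatMap'] at h1
      rw [h1]
      conv_rhs => unfold Wk
      rw [if_neg (by simp only [h]; omega), List.map_flatMap, sum_flatMap']
      apply congrArg (fun x => x % Q)
      congr 1
      apply List.map_congr_left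
      intro v _
      split_ifs with h3
      · rw [List.map_map, List.map_map]
        congr 1
        apply List.map_congr_left
        intro l _
        simp only [Function.comp_def, wsum, List.map_cons, List.sum_cons]
        congr 1
        ring
      · rfl

/-- All walks with nine edges. -/
def allWk (u : ℕ → ℕ) (K j : ℕ) : List (List ℕ) := (List.range 19).flatMap (Wk u K j)

theorem run_count (z : ℕ) (pre : List ℕ) (hU : (pre ++ slots).length = 19)
    (hu : ∀ a, (pre ++ slots).getD a 0 = 0 ∨ (pre ++ slots).getD a 0 = 43 * wt a + 1) :
    run z pre =
      (allWk (fun a => (pre ++ slots).getD a 0) (z + 18) 9).countP (fun l => wsum l = 32767) := by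
  obtain ⟨h1, h2⟩ := state_eq _ mask and_mask z _ hU hu 9
  have h3 := top_sum (2 ^ 43) 32766
    ((allWk (fun a => (pre ++ slots).getD a 0) (z + 18) 9).map wsum) (by
    rw [List.length_map, allWk, List.length_flatMap]
    refine (sum_le_of _ 19 (19 ^ 9) ?_).trans_lt (by norm_num)
    intro v _
    exact Wk_length _ _ 9 v)
  have h4 : (2 : ℕ) ^ 1408981 = (2 ^ 43) ^ (32766 + 1) := by
    have e : 1408981 = 43 * (32766 + 1) := by norm_num
    rw [e, pow_mul]
  have h5 := sum_modEq (List.range 19) _ _ h2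
  rw [run_eq, total_eq, h1, and_mask, Nat.shiftRight_eq_div_pow, h4, h5]
  rw [List.map_map, allWk, List.map_flatMap, sum_flatMap'] at h3
  simp only [Function.comp_def] at h3
  refine h3.trans ?_
  rw [← allWk, List.count, List.countP_map]
  congr 1

/-! ### From walks to sets of label sequences -/

/-- Every edge has weight `K`. -/
def Ch (K : ℕ) (l : List ℕ) : Prop :=
  ∀ i, 2 * i + 2 < l.length → l.getD (2 * i) 0 + l.getD (2 * i + 1) 0 + l.getD (2 * i + 2) 0 = K

theorem Ch_cons (K w e v : ℕ) (l : List ℕ) :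
    Ch K (w :: e :: v :: l) ↔ w + e + v = K ∧ Ch K (v :: l) := by
  constructor
  · intro h
    refine ⟨by simpa using h 0 (by simp), fun i hi => ?_⟩
    have := h (i + 1) (by simp only [List.length_cons] at hi ⊢; omega)
    have e1 : 2 * (i + 1) = 2 * i + 1 + 1 := by ring
    rw [e1] at this
    simpa only [List.getD_cons_succ] using this
  · rintro ⟨h1, h2⟩ i hi
    cases i with
    | zero => simpa using h1
    | succ i =>
      have := h2 i (by simp only [List.length_cons] at hi ⊢; omega)
      have e1 : 2 * (i + 1) = 2 * i + 1 + 1 := by ring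
      rw [e1]
      simpa only [List.getD_cons_succ] using this

theorem mem_Wk (u : ℕ → ℕ) (hu : ∀ a, 19 ≤ a → u a = 0) (K j w : ℕ) (l : List ℕ) :
    l ∈ Wk u K j w ↔ l.length = 2 * j + 1 ∧ l.head? = some w ∧ Ch K l ∧ ∀ a ∈ l, u a ≠ 0 := by
  induction j generalizing w l with
  | zero =>
    unfold Wk
    constructor
    · split_ifs with h
      · simp
      · intro hl
        rw [List.mem_singleton] at hl
        subst hl
        refine ⟨rfl, rfl, ?_, by simpa using h⟩
        intro i hi
        simp at hi
    · rintro ⟨h1, h2, -, h4⟩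
      obtain ⟨x, rfl⟩ := List.length_eq_one_iff.1 h1
      simp at h2
      subst h2
      rw [if_neg (h4 _ (by simp))]
      simp
  | succ j ih =>
    unfold Wk
    constructor
    · split_ifs with h
      · simp
      · intro hl
        obtain ⟨v, hv, hl⟩ := List.mem_flatMap.1 hl
        split_ifs at hl with h3
        · obtain ⟨l', hl', rfl⟩ := List.mem_map.1 hl
          obtain ⟨i1, i2, i3, i4⟩ := (ih v l').1 hl'
          refine ⟨by simp [i1]; ring, rfl, ?_, ?_⟩
          · cases l' with
            | nil => simp at i2
            | cons x xs =>
              simp at i2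
              subst i2
              rw [Ch_cons]
              exact ⟨by omega, i3⟩
          · intro a ha
            simp only [List.mem_cons] at ha
            rcases ha with rfl | rfl | ha
            · exact h
            · exact h3.2
            · exact i4 a ha
        · simp at hl
    · rintro ⟨h1, h2, h3, h4⟩
      match l, h1, h2, h3, h4 with
      | x :: e :: v :: l', h1, h2, h3, h4 =>
        simp at h2
        subst h2
        rw [Ch_cons] at h3
        have hx : u x ≠ 0 := h4 _ (by simp)
        have he : u e ≠ 0 := h4 _ (by simp)
        have hv : u v ≠ 0 := h4 _ (by simp)
        rw [if_neg hx, List.mem_flatMap]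
        have hv19 : v < 19 := by
          by_contra hc
          exact hv (hu v (by omega))
        have hK : K - x - v = e := by omega
        refine ⟨v, List.mem_range.2 hv19, ?_⟩
        rw [hK, if_pos ⟨by omega, he⟩, List.mem_map]
        refine ⟨v :: l', (ih v _).2 ⟨?_, rfl, h3.2, ?_⟩, rfl⟩
        · simp only [List.length_cons] at h1 ⊢
          omega
        · intro a ha
          exact h4 a (List.mem_cons_of_mem _ (List.mem_cons_of_mem _ ha))
      | [], h1, h2, h3, h4 => simp at h1
      | [x], h1, h2, h3, h4 => simp at h1
      | [x, e], h1, h2, h3, h4 => simp at h1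

theorem nodup_flatMap_range (f : ℕ → List (List ℕ)) (n : ℕ) (h1 : ∀ v, (f v).Nodup)
    (h2 : ∀ v w l, l ∈ f v → l ∈ f w → v = w) : ((List.range n).flatMap f).Nodup := by
  rw [List.nodup_flatMap]
  refine ⟨fun v _ => h1 v, ?_⟩
  refine List.Pairwise.imp ?_ (List.nodup_range (n := n))
  intro v w hvw l hl hl'
  exact hvw (h2 v w l hl hl')

theorem nodup_Wk (u : ℕ → ℕ) (hu : ∀ a, 19 ≤ a → u a = 0) (K j w : ℕ) :
    (Wk u K j w).Nodup := by
  induction j generalizing w with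
  | zero => unfold Wk; split_ifs <;> simp
  | succ j ih =>
    unfold Wk
    split_ifs
    · simp
    · apply nodup_flatMap_range
      · intro v
        split_ifs
        · exact (ih v).map (fun a b hab => by simpa using hab)
        · simp
      · intro v v' l hl hl'
        split_ifs at hl hl'
        · obtain ⟨a, ha, rfl⟩ := List.mem_map.1 hl
          obtain ⟨b, hb, hab⟩ := List.mem_map.1 hl'
          simp only [List.cons.injEq, true_and] at hab
          have h1 := ((mem_Wk u hu K j v a).1 ha).2.1
          have h2 := ((mem_Wk u hu K j v' b).1 hb).2.1
          rw [hab.2, h1] at h2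
          simpa using h2
        all_goals simp at hl hl'

theorem mem_allWk (u : ℕ → ℕ) (hu : ∀ a, 19 ≤ a → u a = 0) (K j : ℕ) (l : List ℕ) :
    l ∈ allWk u K j ↔ l.length = 2 * j + 1 ∧ Ch K l ∧ ∀ a ∈ l, u a ≠ 0 := by
  unfold allWk
  rw [List.mem_flatMap]
  constructor
  · rintro ⟨w, -, h⟩
    obtain ⟨h1, -, h3⟩ := (mem_Wk u hu K j w l).1 h
    exact ⟨h1, h3⟩
  · rintro ⟨h1, h3, h4⟩
    cases l with
    | nil => simp at h1
    | cons x xs =>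
      refine ⟨x, List.mem_range.2 ?_, (mem_Wk u hu K j x _).2 ⟨h1, rfl, h3, h4⟩⟩
      by_contra hc
      exact h4 x (by simp) (hu x (by omega))

theorem nodup_allWk (u : ℕ → ℕ) (hu : ∀ a, 19 ≤ a → u a = 0) (K j : ℕ) :
    (allWk u K j).Nodup := by
  apply nodup_flatMap_range _ _ (nodup_Wk u hu K j)
  intro v w l hl hl'
  have h1 := ((mem_Wk u hu K j v l).1 hl).2.1
  have h2 := ((mem_Wk u hu K j w l).1 hl').2.1
  rw [h1] at h2
  simpa using h2

/-- Label sequences with allowed labels, total weight as large as possible, containing all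
labels below `n`. -/
def S (u : ℕ → ℕ) (K n : ℕ) : Set (List ℕ) :=
  {l | l.length = 19 ∧ Ch K l ∧ (∀ a ∈ l, u a ≠ 0) ∧ wsum l = 32767 ∧ ∀ a < n, a ∈ l}

theorem S_zero_eq (u : ℕ → ℕ) (hu : ∀ a, 19 ≤ a → u a = 0) (K : ℕ) :
    S u K 0 = ((allWk u K 9).filter (fun l => wsum l = 32767)).toFinset := by
  ext l
  simp only [S, Set.mem_ofPred_eq, List.coe_toFinset, List.mem_filter, mem_allWk u hu,
    decide_eq_true_eq]
  constructor
  · rintro ⟨h1, h2, h3, h4, -⟩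
    exact ⟨⟨h1, h2, h3⟩, h4⟩
  · rintro ⟨⟨h1, h2, h3⟩, h4⟩
    exact ⟨h1, h2, h3, h4, by simp⟩

theorem S_zero_ncard (u : ℕ → ℕ) (hu : ∀ a, 19 ≤ a → u a = 0) (K : ℕ) :
    (S u K 0).ncard = (allWk u K 9).countP (fun l => wsum l = 32767) := by
  rw [S_zero_eq u hu, Set.ncard_coe_finset, List.toFinset_card_of_nodup
    ((nodup_allWk u hu K 9).filter _), List.countP_eq_length_filter]

theorem S_finite (u : ℕ → ℕ) (hu : ∀ a, 19 ≤ a → u a = 0) (K n : ℕ) : (S u K n).Finite := by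
  have h : (S u K 0).Finite := by
    rw [S_zero_eq u hu]
    exact Finset.finite_toSet _
  refine h.subset ?_
  rintro l ⟨h1, h2, h3, h4, -⟩
  exact ⟨h1, h2, h3, h4, by simp⟩

/-- The labels encoded by `pre`, with the first `n` labels allowed. -/
def uu (n : ℕ) (pre : List ℕ) (a : ℕ) : ℕ := (List.replicate n 1 ++ (pre ++ slots)).getD a 0

theorem uu_big (n : ℕ) (pre : List ℕ) (h : n + pre.length = 4) (a : ℕ) (ha : 19 ≤ a) :
    uu n pre a = 0 := by
  unfold uu
  rw [List.getD_eq_default]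
  simp [slots]
  omega

theorem uu_one (n : ℕ) (pre : List ℕ) : uu n (1 :: pre) = uu (n + 1) pre := by
  funext a
  unfold uu
  rw [List.replicate_succ']
  simp

theorem uu_zero (n : ℕ) (pre : List ℕ) (a : ℕ) :
    uu n (0 :: pre) a = if a = n then 0 else uu (n + 1) pre a := by
  rw [← uu_one]
  unfold uu
  split_ifs with h
  · subst h
    rw [List.getD_append_right _ _ _ _ (by simp)]
    simp
  · by_cases h2 : a < n
    · rw [List.getD_append _ _ _ _ (by simpa using h2), List.getD_append _ _ _ _ (by simpa using h2)]
    · rw [List.getD_append_right (List.replicate n 1) _ 0 a (by simp; omega),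
        List.getD_append_right (List.replicate n 1) _ 0 a (by simp; omega)]
      obtain ⟨k, hk⟩ : ∃ k, a - (List.replicate n 1).length = k + 1 :=
        ⟨a - n - 1, by simp; omega⟩
      rw [hk]
      simp

theorem uu_self (n : ℕ) (pre : List ℕ) : uu (n + 1) pre n ≠ 0 := by
  unfold uu
  rw [List.getD_append _ _ _ _ (by simp)]
  simp [List.getD_eq_getElem?_getD]

theorem slots_getD (i : ℕ) : slots.getD i 0 = 0 ∨ slots.getD i 0 = 43 * 2 ^ i + 1 := by
  by_cases h : i < 15
  · right
    interval_cases i <;> rfl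
  · left
    rw [List.getD_eq_default]
    simp [slots]
    omega

theorem IE_eq (z n : ℕ) (pre : List ℕ) (h : n + pre.length = 4) (hp : ∀ x ∈ pre, x = 0 ∨ x = 1) :
    IE z n pre = (S (uu n pre) (z + 18) n).ncard := by
  induction n generalizing pre with
  | zero =>
    have h0 : IE z 0 pre = run z pre := rfl
    have h1 : uu 0 pre = fun a => (pre ++ slots).getD a 0 := rfl
    rw [h0, S_zero_ncard _ (uu_big 0 pre h), h1]
    apply run_count
    · simp [slots]
      omega
    · intro a
      by_cases ha : a < 4
      · rw [List.getD_append _ _ _ _ (by omega)]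
        have : wt a = 0 := by simp [wt, ha]
        rw [this, List.getD_eq_getElem _ _ (by omega)]
        simpa using hp _ (List.getElem_mem _)
      · rw [List.getD_append_right _ _ _ _ (by omega)]
        have h4 : pre.length = 4 := by omega
        have : wt a = 2 ^ (a - 4) := by simp [wt, ha]
        rw [this, h4]
        exact slots_getD _
  | succ n ih =>
    have h0 : IE z (n + 1) pre = IE z n (1 :: pre) - IE z n (0 :: pre) := rfl
    rw [h0, ih (1 :: pre) (by simp; omega) (by simpa using hp),
      ih (0 :: pre) (by simp; omega) (by simpa using hp), uu_one]
    have hsub : S (uu n (0 :: pre)) (z + 18) n ⊆ S (uu (n + 1) pre) (z + 18) n := by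
      rintro l ⟨h1, h2, h3, h4⟩
      refine ⟨h1, h2, ?_, h4⟩
      intro a ha
      have := h3 a ha
      rw [uu_zero] at this
      split_ifs at this
      · exact absurd rfl this
      · exact this
    rw [← Set.ncard_sdiff hsub (S_finite _ (uu_big n (0 :: pre) (by simp; omega)) _ _)]
    congr 1
    ext l
    constructor
    · rintro ⟨⟨h1, h2, h3, h4, h5⟩, h6⟩
      refine ⟨h1, h2, h3, h4, ?_⟩
      intro a ha
      by_cases han : a < n
      · exact h5 a han
      · have : a = n := by omega
        subst this
        by_contra hc
        apply h6
        refine ⟨h1, h2, ?_, h4, h5⟩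
        intro b hb
        rw [uu_zero, if_neg (by rintro rfl; exact hc hb)]
        exact h3 b hb
    · rintro ⟨h1, h2, h3, h4, h5⟩
      refine ⟨⟨h1, h2, h3, h4, fun a ha => h5 a (by omega)⟩, ?_⟩
      rintro ⟨-, -, h6, -⟩
      have := h6 n (h5 n (by omega))
      rw [uu_zero, if_pos rfl] at this
      exact this rfl

/-! ### Sequences of the right weight are permutations -/

theorem pow_cover (m : ℕ) (s : Multiset ℕ) (hs : (s.map fun x => 2 ^ x).sum + 1 = 2 ^ m) :
    m ≤ s.card ∧ (s.card = m → ∀ i < m, i ∈ s) := by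
  induction m generalizing s with
  | zero => exact ⟨Nat.zero_le _, fun _ i hi => absurd hi (by omega)⟩
  | succ m ih =>
    have key : ∀ s : Multiset ℕ, (s.map fun x => 2 ^ x).sum =
        s.count 0 + 2 * (((s.filter (· ≠ 0)).map (· - 1)).map fun x => 2 ^ x).sum ∧
        s.card = s.count 0 + ((s.filter (· ≠ 0)).map (· - 1)).card := by
      intro s
      induction s using Multiset.induction_on with
      | empty => simp
      | cons a s ih =>
        obtain ⟨i1, i2⟩ := ih
        cases a with
        | zero =>
          simp only [Multiset.map_cons, Multiset.sum_cons, i1, Multiset.card_cons, i2]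
          rw [Multiset.count_cons_self, Multiset.filter_cons_of_neg _ (by simp)]
          constructor
          · simp only [pow_zero]; ring
          · ring
        | succ a =>
          simp only [Multiset.map_cons, Multiset.sum_cons, i1, Multiset.card_cons, i2]
          rw [Multiset.count_cons_of_ne (by simp), Multiset.filter_cons_of_pos _ (by simp)]
          simp only [Multiset.map_cons, Multiset.sum_cons, Multiset.card_cons,
            Nat.add_sub_cancel]
          constructor
          · rw [pow_succ]; ring
          · ring
    obtain ⟨k1, k2⟩ := key s
    rw [pow_succ] at hs
    generalize ht : (s.filter (· ≠ 0)).map (· - 1) = t at k1 k2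
    obtain ⟨q, hq⟩ : ∃ q, s.count 0 = 2 * q + 1 := ⟨s.count 0 / 2, by omega⟩
    obtain ⟨j1, j2⟩ := ih (t + Multiset.replicate q 0) (by
      rw [Multiset.map_add, Multiset.sum_add, Multiset.map_replicate, Multiset.sum_replicate]
      simp only [pow_zero, smul_eq_mul, mul_one]
      omega)
    rw [Multiset.card_add, Multiset.card_replicate] at j1 j2
    refine ⟨by omega, fun hc i hi => ?_⟩
    have hq0 : q = 0 := by omega
    subst hq0
    cases i with
    | zero => exact Multiset.count_pos.1 (by omega)
    | succ i =>
      have hi' := j2 (by omega) i (by omega)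
      simp only [Multiset.replicate_zero, add_zero] at hi'
      rw [← ht, Multiset.mem_map] at hi'
      obtain ⟨x, hx, hxi⟩ := hi'
      rw [Multiset.mem_filter] at hx
      have : x = i + 1 := by omega
      exact this ▸ hx.1

theorem contains_all (l : List ℕ) (h1 : l.length = 19) (h2 : wsum l = 32767)
    (h3 : ∀ a < 4, a ∈ l) : ∀ a < 19, a ∈ l := by
  have key : ∀ l : List ℕ, (((l.filter (4 ≤ ·)).map (· - 4)).map fun x => 2 ^ x).sum = wsum l ∧
      l.length = (l.filter (· < 4)).length + ((l.filter (4 ≤ ·)).map (· - 4)).length := by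
    intro l
    induction l with
    | nil => simp [wsum]
    | cons a l ih =>
      obtain ⟨i1, i2⟩ := ih
      have hw : wsum (a :: l) = wt a + wsum l := by simp [wsum]
      rw [hw]
      by_cases ha : a < 4
      · have ha' : ¬ 4 ≤ a := by omega
        rw [List.filter_cons_of_neg (by simpa using ha), List.filter_cons_of_pos (by simpa using ha)]
        refine ⟨?_, ?_⟩
        · rw [i1]
          simp [wt, ha]
        · simp only [List.length_cons]
          omega
      · have ha' : 4 ≤ a := by omega
        rw [List.filter_cons_of_pos (by simpa using ha'),
          List.filter_cons_of_neg (by simpa using ha')]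
        refine ⟨?_, ?_⟩
        · rw [List.map_cons, List.map_cons, List.sum_cons, i1]
          simp [wt, ha]
        · simp only [List.length_cons, List.map_cons]
          omega
  obtain ⟨k1, k2⟩ := key l
  have h4 : 4 ≤ (l.filter (· < 4)).length := by
    have hs : Finset.range 4 ⊆ (l.filter (· < 4)).toFinset := by
      intro a ha
      rw [List.mem_toFinset, List.mem_filter]
      have := Finset.mem_range.1 ha
      exact ⟨h3 a this, by simpa using this⟩
    have := (Finset.card_le_card hs).trans (List.toFinset_card_le _)
    simpa using this
  obtain ⟨p1, p2⟩ := pow_cover 15 ((l.filter (4 ≤ ·)).map (· - 4) : List ℕ) (by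
    rw [Multiset.map_coe, Multiset.sum_coe, k1, h2]
    norm_num)
  rw [Multiset.coe_card] at p1 p2
  have p3 := p2 (by omega)
  intro a ha
  by_cases ha4 : a < 4
  · exact h3 a ha4
  · have := p3 (a - 4) (by omega)
    rw [Multiset.mem_coe, List.mem_map] at this
    obtain ⟨x, hx, hxa⟩ := this
    rw [List.mem_filter] at hx
    have hx2 : 4 ≤ x := by simpa using hx.2
    have : x = a := by omega
    exact this ▸ hx.1

/-! ### Permutations -/

/-- Edge-magic with (zero-based) constant `K`. -/
def PM (K : ℕ) (σ : Equiv.Perm (Fin 19)) : Prop :=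
  ∀ i : Fin 9, (σ ⟨2 * i.1, by omega⟩).val + (σ ⟨2 * i.1 + 1, by omega⟩).val +
    (σ ⟨2 * i.1 + 2, by omega⟩).val = K

theorem wsum_perm (σ : Equiv.Perm (Fin 19)) :
    wsum (List.ofFn fun i => (σ i).val) = 32767 := by
  unfold wsum
  rw [List.map_ofFn, List.sum_ofFn]
  have := Equiv.sum_comp σ (fun i : Fin 19 => wt i.val)
  simp only [Function.comp_def]
  rw [this]
  decide

theorem uu_small : ∀ a < 19, uu 4 [] a ≠ 0 := by decide

theorem S_perm (K : ℕ) : S (uu 4 []) K 4 =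
    (fun σ : Equiv.Perm (Fin 19) => List.ofFn fun i => (σ i).val) '' {σ | PM K σ} := by
  ext l
  constructor
  · rintro ⟨h1, h2, h3, h4, h5⟩
    have hall := contains_all l h1 h4 h5
    have hlt : ∀ a ∈ l, a < 19 := by
      intro a ha
      by_contra hc
      exact h3 a ha (uu_big 4 [] rfl a (by omega))
    let f : Fin 19 → Fin 19 := fun i => ⟨l[i.val]'(by omega), hlt _ (List.getElem_mem _)⟩
    have hf : Function.Surjective f := by
      intro a
      obtain ⟨i, hi, hia⟩ := List.getElem_of_mem (hall a.val a.isLt)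
      exact ⟨⟨i, by omega⟩, Fin.ext hia⟩
    have hb : Function.Bijective f := Finite.surjective_iff_bijective.1 hf
    refine ⟨Equiv.ofBijective f hb, ?_, ?_⟩
    · intro i
      have := h2 i.val (by omega)
      rw [List.getD_eq_getElem _ _ (by omega), List.getD_eq_getElem _ _ (by omega),
        List.getD_eq_getElem _ _ (by omega)] at this
      exact this
    · apply List.ext_getElem
      · simp [h1]
      · intro i hi1 hi2
        simp only [List.getElem_ofFn]
        rfl
  · rintro ⟨σ, hσ, rfl⟩
    refine ⟨by simp, ?_, ?_, wsum_perm σ, ?_⟩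
    · intro i hi
      simp only [List.length_ofFn] at hi
      have := hσ ⟨i, by omega⟩
      rw [List.getD_eq_getElem _ _ (by simp; omega), List.getD_eq_getElem _ _ (by simp; omega),
        List.getD_eq_getElem _ _ (by simp; omega)]
      simp only [List.getElem_ofFn]
      exact this
    · intro a ha
      rw [List.mem_ofFn] at ha
      obtain ⟨i, rfl⟩ := ha
      exact uu_small _ (σ i).isLt
    · intro a ha
      rw [List.mem_ofFn]
      exact ⟨σ.symm ⟨a, by omega⟩, by simp⟩

open Classical in
theorem card_PM (z : ℕ) :
    (Finset.univ.filter fun σ : Equiv.Perm (Fin 19) => PM (z + 18) σ).card = IE z 4 [] := by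
  rw [IE_eq z 4 [] rfl (by simp), S_perm, Set.ncard_image_of_injective]
  · rw [← Set.ncard_coe_finset]
    congr 1
    ext σ
    simp
  · intro σ τ h
    have h' := List.ofFn_injective h
    ext i
    exact congrFun h' i

theorem sum_range_card_le (T : Finset ℕ) : ∑ i ∈ Finset.range T.card, i ≤ ∑ i ∈ T, i := by
  induction T using Finset.induction_on_max with
  | empty => simp
  | insert a s hs ih =>
    have ha : a ∉ s := fun h => lt_irrefl _ (hs a h)
    rw [Finset.card_insert_of_notMem ha, Finset.sum_range_succ, Finset.sum_insert ha]
    have : s.card ≤ a := by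
      have := Finset.card_le_card (t := Finset.range a) (fun x hx => Finset.mem_range.2 (hs x hx))
      simpa using this
    omega

theorem PM_lower (K : ℕ) (σ : Equiv.Perm (Fin 19)) (h : PM K σ) : 23 ≤ K := by
  have h1 : ∑ i : Fin 19, (σ i).val = 171 := by
    rw [Equiv.sum_comp σ (fun i : Fin 19 => i.val)]
    decide
  have h2 : 28 ≤ ∑ i : Fin 8, (σ ⟨2 * i.1 + 2, by omega⟩).val := by
    have hinj : Function.Injective fun i : Fin 8 => (σ ⟨2 * i.1 + 2, by omega⟩).val := by
      intro i j hij
      have := σ.injective (Fin.ext hij)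
      simp only [Fin.mk.injEq] at this
      ext
      omega
    have := sum_range_card_le
      (Finset.univ.image fun i : Fin 8 => (σ ⟨2 * i.1 + 2, by omega⟩).val)
    rw [Finset.card_image_of_injective _ hinj, Finset.sum_image (fun a _ b _ hab => hinj hab)]
      at this
    refine le_trans ?_ this
    decide
  let a : ℕ → ℕ := fun i => if h : i < 19 then (σ ⟨i, h⟩).val else 0
  have ha : ∀ i (hi : i < 19), (σ ⟨i, hi⟩).val = a i := by
    intro i hi
    simp only [a, hi, dif_pos]
  have h1' : ∑ i ∈ Finset.range 19, a i = 171 := by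
    rw [Finset.sum_range, ← h1]
    exact Finset.sum_congr rfl fun i _ => (ha i.val i.isLt).symm
  have h2' : 28 ≤ ∑ i ∈ Finset.range 8, a (2 * i + 2) := by
    rw [Finset.sum_range]
    refine h2.trans (le_of_eq ?_)
    exact Finset.sum_congr rfl fun i _ => ha _ _
  have h3 : ∀ i, i < 9 → a (2 * i) + a (2 * i + 1) + a (2 * i + 2) = K := by
    intro i hi
    rw [← h ⟨i, hi⟩, ha, ha, ha]
  clear_value a
  have e0 := h3 0 (by omega)
  have e1 := h3 1 (by omega)
  have e2 := h3 2 (by omega)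
  have e3 := h3 3 (by omega)
  have e4 := h3 4 (by omega)
  have e5 := h3 5 (by omega)
  have e6 := h3 6 (by omega)
  have e7 := h3 7 (by omega)
  have e8 := h3 8 (by omega)
  clear h1 h2 h3 ha
  simp only [Finset.sum_range_succ, Finset.sum_range_zero] at h1' h2'
  norm_num at h1' h2' e0 e1 e2 e3 e4 e5 e6 e7 e8
  omega

/-! ### Symmetries and the final count -/

theorem PM_compl (K : ℕ) (hK : K ≤ 54) (σ : Equiv.Perm (Fin 19)) (h : PM K σ) :
    PM (54 - K) (σ.trans Fin.revPerm) := by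
  intro i
  have hi := h i
  simp only [Equiv.trans_apply, Fin.revPerm_apply, Fin.val_rev]
  have b0 := (σ ⟨2 * i.1, by omega⟩).isLt
  have b1 := (σ ⟨2 * i.1 + 1, by omega⟩).isLt
  have b2 := (σ ⟨2 * i.1 + 2, by omega⟩).isLt
  omega

theorem PM_le (K : ℕ) (σ : Equiv.Perm (Fin 19)) (h : PM K σ) : K ≤ 54 := by
  have hi := h 0
  have b0 := (σ ⟨2 * (0 : Fin 9).1, by decide⟩).isLt
  have b1 := (σ ⟨2 * (0 : Fin 9).1 + 1, by decide⟩).isLt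
  have b2 := (σ ⟨2 * (0 : Fin 9).1 + 2, by decide⟩).isLt
  omega

theorem PM_upper (K : ℕ) (σ : Equiv.Perm (Fin 19)) (h : PM K σ) : K ≤ 31 := by
  have h1 := PM_le K σ h
  have := PM_lower _ _ (PM_compl K h1 σ h)
  omega

theorem PM_rev (K : ℕ) (σ : Equiv.Perm (Fin 19)) (h : PM K σ) :
    PM K (Fin.revPerm.trans σ) := by
  intro i
  have hi := h i.rev
  rw [← hi]
  simp only [Equiv.trans_apply, Fin.revPerm_apply]
  have c0 : Fin.rev (⟨2 * i.1, by omega⟩ : Fin 19) = ⟨2 * i.rev.1 + 2, by omega⟩ := by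
    ext; simp only [Fin.val_rev]; omega
  have c1 : Fin.rev (⟨2 * i.1 + 1, by omega⟩ : Fin 19) = ⟨2 * i.rev.1 + 1, by omega⟩ := by
    ext; simp only [Fin.val_rev]; omega
  have c2 : Fin.rev (⟨2 * i.1 + 2, by omega⟩ : Fin 19) = ⟨2 * i.rev.1, by omega⟩ := by
    ext; simp only [Fin.val_rev]; omega
  rw [c0, c1, c2]
  omega

open Classical in
/-- Number of labelings with zero-based magic constant `K`. -/
noncomputable def cnt (K : ℕ) : ℕ :=
  (Finset.univ.filter fun σ : Equiv.Perm (Fin 19) => PM K σ).card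

theorem cnt_symm_le (K : ℕ) (hK : K ≤ 54) : cnt K ≤ cnt (54 - K) := by
  classical
  unfold cnt
  refine Finset.card_le_card_of_injOn (fun σ => σ.trans Fin.revPerm) ?_ ?_
  · intro σ hσ
    have hσ' : PM K σ := by simpa using hσ
    have := PM_compl K hK σ hσ'
    simpa using this
  · intro σ _ τ _ h
    ext i : 1
    have := congrArg (fun e : Equiv.Perm (Fin 19) => e i) h
    simpa using this

theorem cnt_symm (K : ℕ) (hK : K ≤ 54) : cnt K = cnt (54 - K) := by
  refine le_antisymm (cnt_symm_le K hK) ?_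
  have := cnt_symm_le (54 - K) (by omega)
  rwa [show 54 - (54 - K) = K by omega] at this

theorem IE_succ (z n : ℕ) (pre : List ℕ) :
    IE z (n + 1) pre = IE z n (1 :: pre) - IE z n (0 :: pre) := rfl

theorem IE_zero (z : ℕ) (pre : List ℕ) : IE z 0 pre = run z pre := rfl

theorem IE_four (z : ℕ) : IE z 4 [] =
    (((run z [1, 1, 1, 1] - run z [0, 1, 1, 1]) - (run z [1, 0, 1, 1] - run z [0, 0, 1, 1])) -
      ((run z [1, 1, 0, 1] - run z [0, 1, 0, 1]) - (run z [1, 0, 0, 1] - run z [0, 0, 0, 1]))) -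
    (((run z [1, 1, 1, 0] - run z [0, 1, 1, 0]) - (run z [1, 0, 1, 0] - run z [0, 0, 1, 0])) -
      ((run z [1, 1, 0, 0] - run z [0, 1, 0, 0]) - (run z [1, 0, 0, 0] - run z [0, 0, 0, 0]))) := by
  rw [IE_succ, IE_succ, IE_succ, IE_succ, IE_succ, IE_succ, IE_succ, IE_succ, IE_succ, IE_succ,
    IE_succ, IE_succ, IE_succ, IE_succ, IE_succ]
  simp only [IE_zero]

set_option maxHeartbeats 0 in
/-- Values of the counting recursion, checked by kernel evaluation. -/
theorem vals :
    (Nat.beq (run 5 [1, 1, 1, 1]) 95040 = true ∧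
    Nat.beq (run 5 [1, 1, 1, 0]) 49544 = true ∧
    Nat.beq (run 5 [1, 1, 0, 1]) 35184 = true ∧
    Nat.beq (run 5 [1, 1, 0, 0]) 16936 = true ∧
    Nat.beq (run 5 [1, 0, 1, 1]) 26032 = true ∧
    Nat.beq (run 5 [1, 0, 1, 0]) 7624 = true ∧
    Nat.beq (run 5 [1, 0, 0, 1]) 5088 = true ∧
    Nat.beq (run 5 [1, 0, 0, 0]) 192 = true ∧
    Nat.beq (run 5 [0, 1, 1, 1]) 19304 = true ∧
    Nat.beq (run 5 [0, 1, 1, 0]) 7344 = true ∧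
    Nat.beq (run 5 [0, 1, 0, 1]) 2752 = true ∧
    Nat.beq (run 5 [0, 1, 0, 0]) 0 = true ∧
    Nat.beq (run 5 [0, 0, 1, 1]) 1840 = true ∧
    Nat.beq (run 5 [0, 0, 1, 0]) 0 = true ∧
    Nat.beq (run 5 [0, 0, 0, 1]) 0 = true ∧
    Nat.beq (run 5 [0, 0, 0, 0]) 0 = true) ∧
    (Nat.beq (run 6 [1, 1, 1, 1]) 356896 = true ∧
    Nat.beq (run 6 [1, 1, 1, 0]) 147648 = true ∧
    Nat.beq (run 6 [1, 1, 0, 1]) 128624 = true ∧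
    Nat.beq (run 6 [1, 1, 0, 0]) 35160 = true ∧
    Nat.beq (run 6 [1, 0, 1, 1]) 115248 = true ∧
    Nat.beq (run 6 [1, 0, 1, 0]) 31032 = true ∧
    Nat.beq (run 6 [1, 0, 0, 1]) 27840 = true ∧
    Nat.beq (run 6 [1, 0, 0, 0]) 1904 = true ∧
    Nat.beq (run 6 [0, 1, 1, 1]) 142540 = true ∧
    Nat.beq (run 6 [0, 1, 1, 0]) 40208 = true ∧
    Nat.beq (run 6 [0, 1, 0, 1]) 35924 = true ∧
    Nat.beq (run 6 [0, 1, 0, 0]) 1344 = true ∧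
    Nat.beq (run 6 [0, 0, 1, 1]) 33192 = true ∧
    Nat.beq (run 6 [0, 0, 1, 0]) 2304 = true ∧
    Nat.beq (run 6 [0, 0, 0, 1]) 5440 = true ∧
    Nat.beq (run 6 [0, 0, 0, 0]) 0 = true) ∧
    (Nat.beq (run 7 [1, 1, 1, 1]) 945098 = true ∧
    Nat.beq (run 7 [1, 1, 1, 0]) 353154 = true ∧
    Nat.beq (run 7 [1, 1, 0, 1]) 365550 = true ∧
    Nat.beq (run 7 [1, 1, 0, 0]) 94662 = true ∧
    Nat.beq (run 7 [1, 0, 1, 1]) 409112 = true ∧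
    Nat.beq (run 7 [1, 0, 1, 0]) 106760 = true ∧
    Nat.beq (run 7 [1, 0, 0, 1]) 121624 = true ∧
    Nat.beq (run 7 [1, 0, 0, 0]) 12200 = true ∧
    Nat.beq (run 7 [0, 1, 1, 1]) 377724 = true ∧
    Nat.beq (run 7 [0, 1, 1, 0]) 99836 = true ∧
    Nat.beq (run 7 [0, 1, 0, 1]) 101360 = true ∧
    Nat.beq (run 7 [0, 1, 0, 0]) 9864 = true ∧
    Nat.beq (run 7 [0, 0, 1, 1]) 129792 = true ∧
    Nat.beq (run 7 [0, 0, 1, 0]) 15520 = true ∧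
    Nat.beq (run 7 [0, 0, 0, 1]) 22464 = true ∧
    Nat.beq (run 7 [0, 0, 0, 0]) 0 = true) ∧
    (Nat.beq (run 8 [1, 1, 1, 1]) 1936538 = true ∧
    Nat.beq (run 8 [1, 1, 1, 0]) 737622 = true ∧
    Nat.beq (run 8 [1, 1, 0, 1]) 862348 = true ∧
    Nat.beq (run 8 [1, 1, 0, 0]) 244092 = true ∧
    Nat.beq (run 8 [1, 0, 1, 1]) 849030 = true ∧
    Nat.beq (run 8 [1, 0, 1, 0]) 247178 = true ∧
    Nat.beq (run 8 [1, 0, 0, 1]) 308296 = true ∧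
    Nat.beq (run 8 [1, 0, 0, 0]) 54424 = true ∧
    Nat.beq (run 8 [0, 1, 1, 1]) 967640 = true ∧
    Nat.beq (run 8 [0, 1, 1, 0]) 288700 = true ∧
    Nat.beq (run 8 [0, 1, 0, 1]) 352152 = true ∧
    Nat.beq (run 8 [0, 1, 0, 0]) 63076 = true ∧
    Nat.beq (run 8 [0, 0, 1, 1]) 353300 = true ∧
    Nat.beq (run 8 [0, 0, 1, 0]) 63520 = true ∧
    Nat.beq (run 8 [0, 0, 0, 1]) 93036 = true ∧
    Nat.beq (run 8 [0, 0, 0, 0]) 7792 = true) ∧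
    (Nat.beq (run 9 [1, 1, 1, 1]) 3554948 = true ∧
    Nat.beq (run 9 [1, 1, 1, 0]) 1511240 = true ∧
    Nat.beq (run 9 [1, 1, 0, 1]) 1601070 = true ∧
    Nat.beq (run 9 [1, 1, 0, 0]) 553864 = true ∧
    Nat.beq (run 9 [1, 0, 1, 1]) 1829802 = true ∧
    Nat.beq (run 9 [1, 0, 1, 0]) 642080 = true ∧
    Nat.beq (run 9 [1, 0, 0, 1]) 702932 = true ∧
    Nat.beq (run 9 [1, 0, 0, 0]) 185368 = true ∧
    Nat.beq (run 9 [0, 1, 1, 1]) 1836292 = true ∧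
    Nat.beq (run 9 [0, 1, 1, 0]) 654708 = true ∧
    Nat.beq (run 9 [0, 1, 0, 1]) 695416 = true ∧
    Nat.beq (run 9 [0, 1, 0, 0]) 179578 = true ∧
    Nat.beq (run 9 [0, 0, 1, 1]) 835872 = true ∧
    Nat.beq (run 9 [0, 0, 1, 0]) 224870 = true ∧
    Nat.beq (run 9 [0, 0, 0, 1]) 250484 = true ∧
    Nat.beq (run 9 [0, 0, 0, 0]) 41572 = true) := by
  refine ⟨⟨?_, ?_, ?_, ?_, ?_, ?_, ?_, ?_, ?_, ?_, ?_, ?_, ?_, ?_, ?_, ?_⟩,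
    ⟨?_, ?_, ?_, ?_, ?_, ?_, ?_, ?_, ?_, ?_, ?_, ?_, ?_, ?_, ?_, ?_⟩,
    ⟨?_, ?_, ?_, ?_, ?_, ?_, ?_, ?_, ?_, ?_, ?_, ?_, ?_, ?_, ?_, ?_⟩,
    ⟨?_, ?_, ?_, ?_, ?_, ?_, ?_, ?_, ?_, ?_, ?_, ?_, ?_, ?_, ?_, ?_⟩,
    ⟨?_, ?_, ?_, ?_, ?_, ?_, ?_, ?_, ?_, ?_, ?_, ?_, ?_, ?_, ?_, ?_⟩⟩ <;> decide +kernel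

theorem cnt_23 : cnt 23 = 6368 := by
  refine (card_PM 5).trans ?_
  obtain ⟨a0, a1, a2, a3, a4, a5, a6, a7, a8, a9, a10, a11, a12, a13, a14, a15⟩ := vals.1
  rw [IE_four,
    Nat.eq_of_beq_eq_true a0, Nat.eq_of_beq_eq_true a1,
    Nat.eq_of_beq_eq_true a2, Nat.eq_of_beq_eq_true a3,
    Nat.eq_of_beq_eq_true a4, Nat.eq_of_beq_eq_true a5,
    Nat.eq_of_beq_eq_true a6, Nat.eq_of_beq_eq_true a7,
    Nat.eq_of_beq_eq_true a8, Nat.eq_of_beq_eq_true a9,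
    Nat.eq_of_beq_eq_true a10, Nat.eq_of_beq_eq_true a11,
    Nat.eq_of_beq_eq_true a12, Nat.eq_of_beq_eq_true a13,
    Nat.eq_of_beq_eq_true a14, Nat.eq_of_beq_eq_true a15]

theorem cnt_24 : cnt 24 = 15200 := by
  refine (card_PM 6).trans ?_
  obtain ⟨a0, a1, a2, a3, a4, a5, a6, a7, a8, a9, a10, a11, a12, a13, a14, a15⟩ := vals.2.1
  rw [IE_four,
    Nat.eq_of_beq_eq_true a0, Nat.eq_of_beq_eq_true a1,
    Nat.eq_of_beq_eq_true a2, Nat.eq_of_beq_eq_true a3,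
    Nat.eq_of_beq_eq_true a4, Nat.eq_of_beq_eq_true a5,
    Nat.eq_of_beq_eq_true a6, Nat.eq_of_beq_eq_true a7,
    Nat.eq_of_beq_eq_true a8, Nat.eq_of_beq_eq_true a9,
    Nat.eq_of_beq_eq_true a10, Nat.eq_of_beq_eq_true a11,
    Nat.eq_of_beq_eq_true a12, Nat.eq_of_beq_eq_true a13,
    Nat.eq_of_beq_eq_true a14, Nat.eq_of_beq_eq_true a15]

theorem cnt_25 : cnt 25 = 33544 := by
  refine (card_PM 7).trans ?_
  obtain ⟨a0, a1, a2, a3, a4, a5, a6, a7, a8, a9, a10, a11, a12, a13, a14, a15⟩ := vals.2.2.1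
  rw [IE_four,
    Nat.eq_of_beq_eq_true a0, Nat.eq_of_beq_eq_true a1,
    Nat.eq_of_beq_eq_true a2, Nat.eq_of_beq_eq_true a3,
    Nat.eq_of_beq_eq_true a4, Nat.eq_of_beq_eq_true a5,
    Nat.eq_of_beq_eq_true a6, Nat.eq_of_beq_eq_true a7,
    Nat.eq_of_beq_eq_true a8, Nat.eq_of_beq_eq_true a9,
    Nat.eq_of_beq_eq_true a10, Nat.eq_of_beq_eq_true a11,
    Nat.eq_of_beq_eq_true a12, Nat.eq_of_beq_eq_true a13,
    Nat.eq_of_beq_eq_true a14, Nat.eq_of_beq_eq_true a15]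

theorem cnt_26 : cnt 26 = 47352 := by
  refine (card_PM 8).trans ?_
  obtain ⟨a0, a1, a2, a3, a4, a5, a6, a7, a8, a9, a10, a11, a12, a13, a14, a15⟩ := vals.2.2.2.1
  rw [IE_four,
    Nat.eq_of_beq_eq_true a0, Nat.eq_of_beq_eq_true a1,
    Nat.eq_of_beq_eq_true a2, Nat.eq_of_beq_eq_true a3,
    Nat.eq_of_beq_eq_true a4, Nat.eq_of_beq_eq_true a5,
    Nat.eq_of_beq_eq_true a6, Nat.eq_of_beq_eq_true a7,
    Nat.eq_of_beq_eq_true a8, Nat.eq_of_beq_eq_true a9,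
    Nat.eq_of_beq_eq_true a10, Nat.eq_of_beq_eq_true a11,
    Nat.eq_of_beq_eq_true a12, Nat.eq_of_beq_eq_true a13,
    Nat.eq_of_beq_eq_true a14, Nat.eq_of_beq_eq_true a15]

theorem cnt_27 : cnt 27 = 62688 := by
  refine (card_PM 9).trans ?_
  obtain ⟨a0, a1, a2, a3, a4, a5, a6, a7, a8, a9, a10, a11, a12, a13, a14, a15⟩ := vals.2.2.2.2
  rw [IE_four,
    Nat.eq_of_beq_eq_true a0, Nat.eq_of_beq_eq_true a1,
    Nat.eq_of_beq_eq_true a2, Nat.eq_of_beq_eq_true a3,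
    Nat.eq_of_beq_eq_true a4, Nat.eq_of_beq_eq_true a5,
    Nat.eq_of_beq_eq_true a6, Nat.eq_of_beq_eq_true a7,
    Nat.eq_of_beq_eq_true a8, Nat.eq_of_beq_eq_true a9,
    Nat.eq_of_beq_eq_true a10, Nat.eq_of_beq_eq_true a11,
    Nat.eq_of_beq_eq_true a12, Nat.eq_of_beq_eq_true a13,
    Nat.eq_of_beq_eq_true a14, Nat.eq_of_beq_eq_true a15]

/-- Edge-magic total labelings. -/
def EM (σ : Equiv.Perm (Fin 19)) : Prop := ∃ K, PM K σ

theorem sum_cnt : ∑ K ∈ Finset.Icc 23 31, cnt K = 267616 := by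
  have h : Finset.Icc 23 31 = ({23, 24, 25, 26, 27, 28, 29, 30, 31} : Finset ℕ) := by decide
  have d28 : cnt 28 = 47352 := (cnt_symm 28 (by norm_num)).trans cnt_26
  have d29 : cnt 29 = 33544 := (cnt_symm 29 (by norm_num)).trans cnt_25
  have d30 : cnt 30 = 15200 := (cnt_symm 30 (by norm_num)).trans cnt_24
  have d31 : cnt 31 = 6368 := (cnt_symm 31 (by norm_num)).trans cnt_23
  rw [h]
  simp [cnt_23, cnt_24, cnt_25, cnt_26, cnt_27, d28, d29, d30, d31]

open Classical in
theorem card_EM : (Finset.univ.filter EM).card = 267616 := by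
  rw [← sum_cnt]
  let g : Equiv.Perm (Fin 19) → ℕ := fun σ => (σ 0).val + (σ 1).val + (σ 2).val
  have hg : ∀ K σ, PM K σ → g σ = K := fun K σ h => h 0
  rw [Finset.card_eq_sum_card_fiberwise (f := g) (t := Finset.Icc 23 31)]
  · refine Finset.sum_congr rfl fun K _ => ?_
    unfold cnt
    congr 1
    ext σ
    simp only [Finset.mem_filter, Finset.mem_univ, true_and]
    constructor
    · rintro ⟨⟨K', h⟩, rfl⟩
      rw [hg K' σ h]
      exact h
    · intro h
      exact ⟨⟨K, h⟩, hg K σ h⟩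
  · intro σ hσ
    have hσ' : EM σ := by simpa using hσ
    obtain ⟨K, h⟩ := hσ'
    rw [hg K σ h]
    simpa using ⟨PM_lower K σ h, PM_upper K σ h⟩

open Classical in
theorem card_half : (Finset.univ.filter fun σ => EM σ ∧ (σ 0).val < (σ 18).val).card = 133808 := by
  have h1 := Finset.card_filter_add_card_filter_not (s := Finset.univ.filter EM)
    (fun σ : Equiv.Perm (Fin 19) => (σ 0).val < (σ 18).val)
  rw [card_EM, Finset.filter_filter, Finset.filter_filter] at h1
  have hr : ∀ σ, EM σ → EM (Fin.revPerm.trans σ) := fun σ ⟨K, h⟩ => ⟨K, PM_rev K σ h⟩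
  have hrr : ∀ σ : Equiv.Perm (Fin 19), Fin.revPerm.trans (Fin.revPerm.trans σ) = σ := by
    intro σ
    ext i : 1
    simp
  have r0 : ∀ σ : Equiv.Perm (Fin 19), (Fin.revPerm.trans σ) 0 = σ 18 := fun σ => rfl
  have r1 : ∀ σ : Equiv.Perm (Fin 19), (Fin.revPerm.trans σ) 18 = σ 0 := fun σ => rfl
  have h2 : (Finset.univ.filter fun σ => EM σ ∧ (σ 0).val < (σ 18).val).card =
      (Finset.univ.filter fun σ => EM σ ∧ ¬ (σ 0).val < (σ 18).val).card := by
    refine Finset.card_nbij' (fun σ => Fin.revPerm.trans σ) (fun σ => Fin.revPerm.trans σ)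
      ?_ ?_ (fun σ _ => hrr σ) (fun σ _ => hrr σ)
    · intro σ hσ
      simp only [Finset.coe_filter, Finset.mem_univ, true_and, Set.mem_ofPred_eq] at hσ ⊢
      refine ⟨hr σ hσ.1, ?_⟩
      rw [r0, r1]
      omega
    · intro σ hσ
      simp only [Finset.coe_filter, Finset.mem_univ, true_and, Set.mem_ofPred_eq] at hσ ⊢
      refine ⟨hr σ hσ.1, ?_⟩
      rw [r0, r1]
      have hne : (σ 0).val ≠ (σ 18).val := by
        intro h
        have := σ.injective (Fin.ext h)
        exact absurd this (by decide)
      omega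
  omega

end P9

/-- The number of edge-magic total labelings of the path `P 9`, counted up to the
reversal symmetry of the path, is `133808`. -/
theorem pathEMTLCountUpToRev_P9 : pathEMTLCountUpToRev 9 = 133808 := by
  rw [← P9.card_half]
  unfold pathEMTLCountUpToRev
  refine congrArg Finset.card ?_
  ext σ
  simp only [Finset.mem_filter]
  refine and_congr_right fun _ => and_congr ?_ Iff.rfl
  constructor
  · rintro ⟨k, h⟩
    refine ⟨k - 3, fun i => ?_⟩
    have hi : ((σ ⟨2 * i.1, by omega⟩).val + 1) + ((σ ⟨2 * i.1 + 1, by omega⟩).val + 1) +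
      ((σ ⟨2 * i.1 + 2, by omega⟩).val + 1) = k := h i
    omega
  · rintro ⟨K, h⟩
    refine ⟨K + 3, fun i => ?_⟩
    have hi : (σ ⟨2 * i.1, by omega⟩).val + (σ ⟨2 * i.1 + 1, by omega⟩).val +
      (σ ⟨2 * i.1 + 2, by omega⟩).val = K := h i
    omega
end
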